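/- arXiv:2109.06863 — 2 statements merged into one kernel-verified Lean document; each statement's English description precedes it below -/
import Mathlib

section
/- Let n ≥ 1, let q ∈ Ĉ be a point of the Riemann sphere, and let C₁, …, Cₙ be non-separating continua in Ĉ such that each Cᵢ contains q and Cᵢ ∩ Cⱼ = {q} for all i ≠ j. Then the complement Ĉ ∖ (C₁ ∪ … ∪ Cₙ) is nonempty, connected, and simply connected (as a topological subspace); in particular, the union C₁ ∪ … ∪ Cₙ does not separate the sphere. -/
open Set

/-- The Riemann sphere, as the one-point compactification of `ℂ`. -/
abbrev RSphere : Type := OnePoint ℂ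

/-- A continuum in the Riemann sphere: a nonempty compact connected set. -/
def IsContinuum (C : Set RSphere) : Prop :=
  C.Nonempty ∧ IsCompact C ∧ IsConnected C

/-- A set is non-separating if its complement in the sphere is nonempty and connected. -/
def NonSeparating (C : Set RSphere) : Prop :=
  Cᶜ.Nonempty ∧ IsConnected Cᶜ

/-- The (contravariantly ordered) product of `a` over the consecutive pairs of a walk. -/
def walkProd {V G : Type*} [Group G] (a : V → V → G) : List V → G
  | [] => 1
  | [_] => 1
  | x :: y :: l => walkProd a (y :: l) * a x y

theorem walkProd_append {V G : Type*} [Group G] (a : V → V → G) (l₁ : List V) (x : V)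
    (l₂ : List V) :
    walkProd a (l₁ ++ x :: l₂) = walkProd a (x :: l₂) * walkProd a (l₁ ++ [x]) := by
  induction l₁ with
  | nil => simp [walkProd]
  | cons y l₁ ih =>
    cases l₁ with
    | nil => simp [walkProd]
    | cons z l₁ => simpa [walkProd, ← mul_assoc] using ih

/-- `p` is not above `v`, and at the height of `v` it is not to the left of `v`. -/
def GridBelow (v p : ℤ × ℤ) : Prop := p.2 < v.2 ∨ p.2 = v.2 ∧ v.1 ≤ p.1

/-- The edges of a grid graph with both ends `GridBelow v`, apart from the edge leading from `v`
to the right. -/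
def OffTopEdge (E : ℤ × ℤ → ℤ × ℤ → Prop) (v p q : ℤ × ℤ) : Prop :=
  E p q ∧ GridBelow v p ∧ GridBelow v q ∧ (p = v → q = (v.1, v.2 - 1)) ∧
    (q = v → p = (v.1, v.2 - 1))

theorem exists_mem_forall_gridBelow {l : List (ℤ × ℤ)} (hl : l ≠ []) :
    ∃ v ∈ l, ∀ p ∈ l, GridBelow v p := by
  obtain ⟨v, hv, h⟩ := Finset.exists_max_image l.toFinset
    (fun p => (toLex (p.2, -p.1) : ℤ ×ₗ ℤ)) (by simpa [Finset.nonempty_iff_ne_empty] using hl)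
  refine ⟨v, by simpa using hv, fun p hp => ?_⟩
  have := h p (by simpa using hp)
  rw [Prod.Lex.toLex_le_toLex] at this
  simpa [GridBelow] using this

/-- A grid vertex adjacent to and `GridBelow` another one is either right of it or under it. -/
theorem GridBelow.eq_or {v p : ℤ × ℤ} (h : GridBelow v p) (hne : p ≠ v)
    (hadj : |p.1 - v.1| + |p.2 - v.2| ≤ 1) : p = (v.1 + 1, v.2) ∨ p = (v.1, v.2 - 1) := by
  obtain ⟨p1, p2⟩ := p
  obtain ⟨v1, v2⟩ := v
  simp only [GridBelow, Prod.mk.injEq, ne_eq] at *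
  grind

theorem reflTransGen_of_isChain {V : Type*} {R : V → V → Prop} {x y : V} {l : List V}
    (h : List.IsChain R (x :: l ++ [y])) : Relation.ReflTransGen R x y := by
  induction l generalizing x with
  | nil => exact .single (by simpa using h)
  | cons z l ih =>
    simp only [List.cons_append, List.isChain_cons_cons] at h
    exact .head h.1 (ih (by simpa using h.2))

/-- If a grid graph is such that every corner at the top of a closed walk spans a square over which
`a` is a cocycle, then the product of `a` over any closed walk is trivial. -/
theorem walkProd_closed_eq_one {G : Type*} [Group G] {a : ℤ × ℤ → ℤ × ℤ → G}
    {E : ℤ × ℤ → ℤ × ℤ → Prop} (hsymm : ∀ p q, E p q → E q p)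
    (hadj : ∀ p q, E p q → |p.1 - q.1| + |p.2 - q.2| ≤ 1)
    (hrefl : ∀ p, E p p → a p p = 1) (hinv : ∀ p q, E p q → a q p * a p q = 1)
    (hsq : ∀ x y, E (x, y) (x + 1, y) →
      Relation.ReflTransGen (OffTopEdge E (x, y)) (x + 1, y) (x, y) →
      E (x + 1, y) (x + 1, y - 1) ∧ E (x, y - 1) (x + 1, y - 1) ∧
        a (x, y) (x + 1, y) * a (x, y - 1) (x, y) =
          a (x + 1, y - 1) (x + 1, y) * a (x, y - 1) (x + 1, y - 1))
    (x : ℤ × ℤ) (l : List (ℤ × ℤ)) (hE : List.IsChain E (x :: l ++ [x])) :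
    walkProd a (x :: l ++ [x]) = 1 := by
  obtain ⟨X, hX⟩ : ∃ X, ∀ p ∈ x :: l, p.1 ≤ X := by
    obtain ⟨X, h⟩ := ((x :: l).toFinset.image Prod.fst).bddAbove
    exact ⟨X, fun p hp => h (Finset.mem_coe.2 (Finset.mem_image_of_mem _ (List.mem_toFinset.2 hp)))⟩
  obtain ⟨Y, hY⟩ : ∃ Y, ∀ p ∈ x :: l, Y ≤ p.2 := by
    obtain ⟨Y, h⟩ := ((x :: l).toFinset.image Prod.snd).bddBelow
    exact ⟨Y, fun p hp => h (Finset.mem_coe.2 (Finset.mem_image_of_mem _ (List.mem_toFinset.2 hp)))⟩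
  set w : ℤ × ℤ → ℕ := fun p => 1 + (X - p.1).toNat + (p.2 - Y).toNat with hw
  obtain ⟨N, hN⟩ : ∃ N, ((x :: l).map w).sum < N := ⟨_, Nat.lt_succ_self _⟩
  induction N generalizing x l with
  | zero => simp at hN
  | succ N ih =>
  have hwpos : ∀ p, 0 < w p := fun p => by simp only [hw]; omega
  -- it is enough to treat walks starting at a top vertex
  have key : ∀ v t, (∀ p ∈ v :: t, p.1 ≤ X) → (∀ p ∈ v :: t, Y ≤ p.2) →
      ((v :: t).map w).sum < N + 1 → List.IsChain E (v :: t ++ [v]) →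
      (∀ p ∈ t, GridBelow v p) → walkProd a (v :: t ++ [v]) = 1 := by
    intro v t htX htY htN htE htv
    by_cases hvt : v ∈ t
    · obtain ⟨t₁, t₂, rfl⟩ := List.append_of_mem hvt
      have e : v :: (t₁ ++ v :: t₂) ++ [v] = (v :: t₁) ++ v :: (t₂ ++ [v]) := by simp
      rw [e] at htE ⊢
      rw [List.isChain_split] at htE
      have := hwpos v
      simp only [List.map_cons, List.map_append, List.sum_cons, List.sum_append] at htN
      rw [walkProd_append, ih v t₁ htE.1, show v :: (t₂ ++ [v]) = v :: t₂ ++ [v] by simp,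
        ih v t₂ (by simpa using htE.2), one_mul]
      all_goals first
        | (intro p hp; first | apply htX | apply htY)
          simp only [List.mem_cons, List.mem_append] at hp ⊢
          tauto
        | (simp only [List.map_cons, List.sum_cons]; omega)
    rcases List.eq_nil_or_concat' t with rfl | ⟨s, c, rfl⟩
    · simp only [List.cons_append, List.nil_append, List.isChain_cons_cons] at htE
      simpa [walkProd] using hrefl v htE.1
    rcases s with - | ⟨b, s⟩
    · simp only [List.cons_append, List.nil_append, List.isChain_cons_cons] at htE
      simpa [walkProd] using hinv v c htE.1
    have hbv : b ≠ v := by rintro rfl; simp at hvt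
    have hcv : c ≠ v := by rintro rfl; simp at hvt
    have hvb : E v b := by
      simp only [List.cons_append, List.isChain_cons_cons] at htE
      exact htE.1
    have htE' : List.IsChain E (b :: s ++ [c]) := by
      have : (v :: (b :: s ++ [c]) ++ [v]) = [v] ++ b :: s ++ [c] ++ [v] := by simp
      rw [this] at htE
      exact ((List.isChain_append.1 htE).1.right_of_append (l₁ := [v]) |> fun h => by simpa using h)
    have hcE : E c v := by
      have : (v :: (b :: s ++ [c]) ++ [v]) = (v :: b :: s) ++ c :: [v] := by simp
      rw [this, List.isChain_split] at htE
      simpa using htE.2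
    have hprod : walkProd a (v :: (b :: s ++ [c]) ++ [v]) =
        a c v * walkProd a (b :: s ++ [c]) * a v b := by
      have : (v :: (b :: s ++ [c]) ++ [v]) = (v :: b :: s) ++ c :: [v] := by simp
      rw [this, walkProd_append]
      simp [walkProd, mul_assoc]
    have hb := (htv b (by simp)).eq_or hbv (hadj _ _ (hsymm _ _ hvb))
    have hc := (htv c (by simp)).eq_or hcv (hadj _ _ hcE)
    have hoff : List.IsChain (OffTopEdge E v) (b :: s ++ [c]) := by
      refine List.IsChain.imp_of_mem_imp (fun p q hp hq h => ⟨h, htv p hp, htv q hq, ?_, ?_⟩) htE'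
      · rintro rfl; exact absurd hp hvt
      · rintro rfl; exact absurd hq hvt
    rw [hprod]
    simp only [List.cons_append, List.map_cons, List.map_append, List.sum_cons, List.sum_append,
      List.map_nil, List.sum_nil] at htN
    have hpos := hwpos v
    have hpos' := hwpos c
    by_cases hbc : b = c
    · subst hbc
      rw [ih b s htE' (fun p hp => htX p (by simp at hp ⊢; tauto))
        (fun p hp => htY p (by simp at hp ⊢; tauto))
        (by simp only [List.map_cons, List.sum_cons]; omega),
        mul_one, hinv _ _ hvb]
    -- push the top vertex down across the square
    have push : ∀ v', E v' b → E c v' → v' = (v.1 + 1, v.2 - 1) → v.1 + 1 ≤ X → Y ≤ v.2 - 1 →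
        a v b * a c v = a v' b * a c v' → a c v * walkProd a (b :: s ++ [c]) * a v b = 1 := by
      intro v' hv'b hcv' hv' hX' hY' hcoc
      have hprod' : walkProd a (v' :: (b :: s ++ [c]) ++ [v']) =
          a c v' * walkProd a (b :: s ++ [c]) * a v' b := by
        have : (v' :: (b :: s ++ [c]) ++ [v']) = (v' :: b :: s) ++ c :: [v'] := by simp
        rw [this, walkProd_append]
        simp [walkProd, mul_assoc]
      have h1 : a c v' * walkProd a (b :: s ++ [c]) * a v' b = 1 := by
        rw [← hprod']
        refine ih v' _ ?_ ?_ ?_ ?_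
        · have : (v' :: (b :: s ++ [c]) ++ [v']) = (v' :: b :: s) ++ c :: [v'] := by simp
          rw [this, List.isChain_split]
          exact ⟨by simpa using ⟨hv'b, htE'⟩, by simpa using hcv'⟩
        · intro p hp
          rcases List.mem_cons.1 hp with rfl | hp
          · rw [hv']; exact hX'
          · exact htX p (List.mem_cons_of_mem _ hp)
        · intro p hp
          rcases List.mem_cons.1 hp with rfl | hp
          · rw [hv']; exact hY'
          · exact htY p (List.mem_cons_of_mem _ hp)
        · have : w v' < w v := by
            simp only [hw, hv']
            omega
          simp only [List.cons_append, List.map_cons, List.map_append, List.sum_cons,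
            List.sum_append, List.map_nil, List.sum_nil]
          omega
      rw [mul_eq_one_comm, ← mul_assoc] at h1 ⊢
      rw [hcoc, h1]
    have hvv : GridBelow v v := .inr ⟨rfl, le_rfl⟩
    have hbX := htX b (by simp)
    have hbY := htY b (by simp)
    have hcX := htX c (by simp)
    have hcY := htY c (by simp)
    obtain ⟨v1, v2⟩ := v
    rcases hb with rfl | rfl <;> rcases hc with rfl | rfl
    · exact absurd rfl hbc
    · obtain ⟨h1, h2, h3⟩ := hsq v1 v2 hvb <| (reflTransGen_of_isChain hoff).trans <|
        .single ⟨hcE, htv _ (by simp), hvv, fun h => absurd h hcv, fun _ => rfl⟩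
      exact push (v1 + 1, v2 - 1) (hsymm _ _ h1) h2 rfl hbX hcY h3
    · obtain ⟨h1, h2, h3⟩ := hsq v1 v2 (hsymm _ _ hcE) <| by
        refine Relation.ReflTransGen.trans ?_ <|
          .single ⟨hsymm _ _ hvb, htv _ (by simp), hvv, fun h => absurd h hbv, fun _ => rfl⟩
        refine Relation.ReflTransGen.mono ?_ _ _ (reflTransGen_of_isChain hoff).swap
        exact fun p q h => ⟨hsymm _ _ h.1, h.2.2.1, h.2.1, h.2.2.2.2, h.2.2.2.1⟩
      refine push (v1 + 1, v2 - 1) (hsymm _ _ h2) h1 rfl hcX hbY ?_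
      rw [eq_inv_of_mul_eq_one_right (hinv _ _ hvb), eq_inv_of_mul_eq_one_right (hinv _ _ hcE),
        eq_inv_of_mul_eq_one_right (hinv _ _ h1),
        eq_inv_of_mul_eq_one_right (hinv _ _ (hsymm _ _ h2)), ← mul_inv_rev, ← mul_inv_rev]
      exact congrArg _ h3
    · exact absurd rfl hbc
  obtain ⟨v, hv, hvl⟩ := exists_mem_forall_gridBelow (List.cons_ne_nil x l)
  obtain ⟨l₁, l₂, hl⟩ := List.append_of_mem hv
  rcases l₁ with - | ⟨x', l₁⟩
  · obtain ⟨rfl, rfl⟩ := List.cons.inj hl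
    exact key _ _ hX hY hN hE fun p hp => hvl p (by simp [hp])
  · obtain ⟨rfl, rfl⟩ := List.cons.inj hl
    have e₁ : x :: (l₁.append (v :: l₂)) ++ [x] = (x :: l₁) ++ v :: (l₂ ++ [x]) := by simp
    have e₂ : v :: (l₂ ++ x :: l₁) ++ [v] = (v :: l₂) ++ x :: (l₁ ++ [v]) := by simp
    rw [e₁] at hE ⊢
    have := key v (l₂ ++ x :: l₁) ?_ ?_ ?_ ?_ ?_
    · rw [e₂, walkProd_append, mul_eq_one_comm] at this
      rw [walkProd_append]
      exact this
    · exact fun p hp => hX p (by simp at hp ⊢; tauto)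
    · exact fun p hp => hY p (by simp at hp ⊢; tauto)
    · simp only [List.append_eq, List.map_cons, List.map_append, List.sum_cons,
        List.sum_append] at hN ⊢
      omega
    · rw [e₂]
      rw [List.isChain_split] at hE ⊢
      exact ⟨hE.2, hE.1⟩
    · exact fun p hp => hvl p (by simp at hp ⊢; tauto)

theorem Complex.isLocallyInjective_exp : IsLocallyInjective Complex.exp := by
  refine fun x => ⟨Metric.ball x 1, Metric.isOpen_ball, Metric.mem_ball_self one_pos, ?_⟩
  intro z hz w hw h
  obtain ⟨n, hn⟩ := Complex.exp_eq_exp_iff_exists_int.1 h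
  have h2 : ‖z - w‖ < 2 := by
    rw [← dist_eq_norm]
    have := dist_triangle_right z w x
    rw [Metric.mem_ball] at hz hw
    linarith
  have h3 : ‖z - w‖ = |(n : ℝ)| * (2 * Real.pi) := by
    rw [hn, add_sub_cancel_left]
    simp [abs_of_pos Real.pi_pos]
  have hn0 : n = 0 := by
    by_contra hne
    have : (1 : ℝ) ≤ |(n : ℝ)| := by exact_mod_cast Int.one_le_abs hne
    nlinarith [Real.pi_gt_three]
  simpa [hn0] using hn

/-- Two continuous logarithms of proportional functions on a preconnected set differ by a
constant. -/
theorem sub_eq_sub_of_exp_eq_mul_exp {X : Type*} [TopologicalSpace X] {s : Set X}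
    (hs : IsPreconnected s) {f g : X → ℂ} (hf : ContinuousOn f s) (hg : ContinuousOn g s) {c : ℂ}
    (h : ∀ z ∈ s, Complex.exp (f z) = c * Complex.exp (g z)) {z w : X} (hz : z ∈ s) (hw : w ∈ s) :
    f z - f w = g z - g w := by
  have := (T2Space.isSeparatedMap Complex.exp).constOn_of_comp Complex.isLocallyInjective_exp
    hs (hf.sub hg) (fun a ha b hb => by
      simp only [Pi.sub_apply, Complex.exp_sub, h a ha, h b hb,
        mul_div_cancel_right₀ _ (Complex.exp_ne_zero _)]) hz hw
  simp only [Pi.sub_apply] at this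
  linear_combination this

/-- On compact subsets of `U`, the functions `z - a` with `a ∉ U` have continuous logarithms. -/
def HasLogOnCompacts (U : Set ℂ) : Prop :=
  ∀ Γ ⊆ U, IsCompact Γ → ∀ a ∉ U, ∃ g : ℂ → ℂ, ContinuousOn g Γ ∧
    ∀ z ∈ Γ, Complex.exp (g z) = z - a

/-- The grid point with given integer coordinates. -/
def gridPoint (p : ℤ × ℤ) : ℂ := ⟨p.1, p.2⟩

/-- Two grid points are joined by an edge in `U` if they are neighbours or equal, and the segment
between them is in `U`. -/
def GridEdge (U : Set ℂ) (p q : ℤ × ℤ) : Prop :=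
  |p.1 - q.1| + |p.2 - q.2| ≤ 1 ∧ segment ℝ (gridPoint p) (gridPoint q) ⊆ U

theorem GridEdge.symm {U : Set ℂ} {p q : ℤ × ℤ} (h : GridEdge U p q) : GridEdge U q p :=
  ⟨by rw [abs_sub_comm q.1, abs_sub_comm q.2]; exact h.1, by rw [segment_symm]; exact h.2⟩

theorem mem_segment_gridPoint {p q : ℤ × ℤ} {z : ℂ}
    (hz : z ∈ segment ℝ (gridPoint p) (gridPoint q)) :
    ∃ s : ℝ, 0 ≤ s ∧ s ≤ 1 ∧ z.re = p.1 + s * (q.1 - p.1) ∧ z.im = p.2 + s * (q.2 - p.2) := by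
  rw [segment_eq_image'] at hz
  obtain ⟨s, hs, rfl⟩ := hz
  exact ⟨s, hs.1, hs.2, by simp [gridPoint], by simp [gridPoint]⟩

/-- A point on an edge which is not the one to the right of `(x, y)` does not lie on the ray from
`a` through the midpoint of that edge. -/
theorem OffTopEdge.neg_div_mem_slitPlane {U : Set ℂ} {x y : ℤ} {p q : ℤ × ℤ}
    (h : OffTopEdge (GridEdge U) (x, y) p q) {a m z : ℂ} (ha : a ∉ U) (hre : (x : ℝ) ≤ a.re)
    (hre' : a.re ≤ x + 1) (him : (y : ℝ) - 1 ≤ a.im) (him' : a.im < y)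
    (hm : m = ⟨x + 1 / 2, y⟩) (hz : z ∈ segment ℝ (gridPoint p) (gridPoint q)) :
    -((z - a) / (m - a)) ∈ Complex.slitPlane := by
  obtain ⟨⟨hadj, hU⟩, hp, hq, hpv, hqv⟩ := h
  have hza : z ≠ a := fun h => ha (h ▸ hU hz)
  have hma : m - a ≠ 0 := by
    intro h
    have := congrArg Complex.im h
    simp [hm] at this
    linarith
  by_contra hslit
  rw [Complex.mem_slitPlane_iff, not_or, not_lt, not_not, Complex.neg_re, Complex.neg_im,
    neg_eq_zero, neg_nonpos] at hslit
  set t := ((z - a) / (m - a)).re with ht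
  have hzt : z - a = t * (m - a) := by
    rw [← div_eq_iff hma]
    exact Complex.ext (by simp [ht]) (by simp [hslit.2])
  have ht0 : t ≠ 0 := by
    rintro h
    rw [h] at hzt
    simp only [Complex.ofReal_zero, zero_mul, sub_eq_zero] at hzt
    exact hza hzt
  have htpos : 0 < t := lt_of_le_of_ne hslit.1 ht0.symm
  have hr := congrArg Complex.re hzt
  have hi := congrArg Complex.im hzt
  simp only [Complex.sub_re, Complex.sub_im, Complex.re_ofReal_mul, Complex.im_ofReal_mul, hm]
    at hr hi
  obtain ⟨s, hs0, hs1, hzr, hzi⟩ := mem_segment_gridPoint hz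
  obtain ⟨p1, p2⟩ := p
  obtain ⟨q1, q2⟩ := q
  have hp2 : p2 ≤ y := by simp only [GridBelow] at hp; omega
  have hq2 : q2 ≤ y := by simp only [GridBelow] at hq; omega
  simp only [Prod.mk.injEq] at *
  have hp2' : (p2 : ℝ) ≤ y := by exact_mod_cast hp2
  have hq2' : (q2 : ℝ) ≤ y := by exact_mod_cast hq2
  have hzy : z.im ≤ y := by nlinarith
  have ht1 : t ≤ 1 := by nlinarith
  have hcases : p1 = q1 ∨ p2 = q2 := by grind
  rcases hcases with h | h
  · subst h
    rw [sub_self, mul_zero, add_zero] at hzr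
    have h1 : (x : ℝ) < z.re := by nlinarith
    have h2 : z.re < x + 1 := by nlinarith
    rw [hzr] at h1 h2
    norm_cast at h1 h2
    omega
  · subst h
    rw [sub_self, mul_zero, add_zero] at hzi
    have h1 : (y : ℝ) - 1 < z.im := by nlinarith
    rw [hzi] at h1
    have h1' : y - 1 < p2 := by exact_mod_cast h1
    have hpy : p2 = y := by omega
    subst hpy
    have : t = 1 := by nlinarith
    rw [this] at hr
    have hrr : z.re = x + 1 / 2 := by linarith
    have hpx : x ≤ p1 := by simp [GridBelow] at hp; exact hp
    have hqx : x ≤ q1 := by simp [GridBelow] at hq; exact hq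
    have : p1 ≠ x := by rintro rfl; have := hpv ⟨rfl, rfl⟩; omega
    have : q1 ≠ x := by rintro rfl; have := hqv ⟨rfl, rfl⟩; omega
    have h3 : (x : ℝ) + 1 ≤ p1 := by norm_cast; omega
    have h4 : (x : ℝ) + 1 ≤ q1 := by norm_cast; omega
    nlinarith

theorem exists_isCompact_of_reflTransGen_offTopEdge {U : Set ℂ} {x y : ℤ} {p q : ℤ × ℤ}
    (h : Relation.ReflTransGen (OffTopEdge (GridEdge U) (x, y)) p q) (hp : gridPoint p ∈ U)
    {a m : ℂ} (ha : a ∉ U) (hre : (x : ℝ) ≤ a.re)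
    (hre' : a.re ≤ x + 1) (him : (y : ℝ) - 1 ≤ a.im) (him' : a.im < y)
    (hm : m = ⟨x + 1 / 2, y⟩) :
    ∃ Γ ⊆ U, IsCompact Γ ∧ gridPoint p ∈ Γ ∧ gridPoint q ∈ Γ ∧
      ∀ g : ℂ → ℂ, ContinuousOn g Γ → (∀ z ∈ Γ, Complex.exp (g z) = z - a) →
        g (gridPoint p) - g (gridPoint q) =
          Complex.log (-((gridPoint p - a) / (m - a))) -
            Complex.log (-((gridPoint q - a) / (m - a))) := by
  induction h with
  | refl => exact ⟨{gridPoint p}, by simpa using hp, isCompact_singleton, rfl, rfl, by simp⟩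
  | @tail q r _ hqr ih =>
    obtain ⟨Γ, hΓ, hc, hpΓ, hqΓ, hg⟩ := ih
    refine ⟨Γ ∪ segment ℝ (gridPoint q) (gridPoint r), union_subset hΓ hqr.1.2,
      hc.union ?_, .inl hpΓ, .inr (right_mem_segment _ _ _), ?_⟩
    · rw [segment_eq_image_lineMap]
      exact isCompact_Icc.image AffineMap.lineMap_continuous
    intro g hgc hge
    have h1 := hg g (hgc.mono subset_union_left) fun z hz => hge z (.inl hz)
    have hslit : ∀ z ∈ segment ℝ (gridPoint q) (gridPoint r),
        -((z - a) / (m - a)) ∈ Complex.slitPlane :=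
      fun z hz => hqr.neg_div_mem_slitPlane ha hre hre' him him' hm hz
    have hma : m - a ≠ 0 := by
      intro h
      have := congrArg Complex.im h
      simp [hm] at this
      linarith
    have h2 := sub_eq_sub_of_exp_eq_mul_exp
      (convex_segment (gridPoint q) (gridPoint r)).isPreconnected
      (hgc.mono subset_union_right) (g := fun z => Complex.log (-((z - a) / (m - a))))
      (ContinuousOn.clog (by fun_prop) hslit) (c := -(m - a)) (fun z hz => by
        rw [hge z (.inr hz), Complex.exp_log (Complex.slitPlane_ne_zero (hslit z hz))]
        field_simp) (left_mem_segment _ _ _) (right_mem_segment _ _ _)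
    linear_combination h1 + h2

theorem square_subset_of_reflTransGen {U : Set ℂ} (hU : HasLogOnCompacts U) {x y : ℤ}
    (hedge : GridEdge U (x, y) (x + 1, y))
    (h : Relation.ReflTransGen (OffTopEdge (GridEdge U) (x, y)) (x + 1, y) (x, y)) {a : ℂ}
    (hre : (x : ℝ) ≤ a.re) (hre' : a.re ≤ x + 1) (him : (y : ℝ) - 1 ≤ a.im) (him' : a.im ≤ y) :
    a ∈ U := by
  by_contra ha
  have hay : a.im < y := by
    refine lt_of_le_of_ne him' fun hy => ha (hedge.2 ?_)
    rw [segment_eq_image']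
    refine ⟨a.re - x, ⟨by linarith, by linarith⟩, Complex.ext ?_ ?_⟩ <;> simp [gridPoint, hy]
  obtain ⟨m, hm⟩ : ∃ m : ℂ, m = ⟨x + 1 / 2, y⟩ := ⟨_, rfl⟩
  have hma : m - a ≠ 0 := by
    intro h
    have := congrArg Complex.im h
    simp [hm] at this
    linarith
  obtain ⟨Γ, hΓ, hc, hrΓ, hvΓ, hg⟩ := exists_isCompact_of_reflTransGen_offTopEdge h
    (hedge.2 (right_mem_segment _ _ _)) ha hre hre' him hay hm
  have hcs : IsCompact (segment ℝ (gridPoint (x, y)) (gridPoint (x + 1, y))) := by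
    rw [segment_eq_image_lineMap]
    exact isCompact_Icc.image AffineMap.lineMap_continuous
  obtain ⟨g, hgc, hge⟩ := hU _ (union_subset hΓ hedge.2) (hc.union hcs) a ha
  have h1 := hg g (hgc.mono subset_union_left) fun z hz => hge z (.inl hz)
  -- on the top edge, `(z - a) / (m - a)` avoids the negative real axis
  have key : ∀ z : ℂ, z.im = y → ((z - a) / (m - a)).im * Complex.normSq (m - a) =
      (m.re - z.re) * (y - a.im) := by
    intro z hz
    have : Complex.normSq (m - a) ≠ 0 := by simpa using hma
    rw [Complex.div_im]
    field_simp
    simp [hz, hm]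
    ring
  have hnorm : 0 < Complex.normSq (m - a) := Complex.normSq_pos.2 hma
  have hslit : ∀ z ∈ segment ℝ (gridPoint (x, y)) (gridPoint (x + 1, y)),
        (z - a) / (m - a) ∈ Complex.slitPlane := by
    intro z hz
    obtain ⟨s, -, -, -, hzi⟩ := mem_segment_gridPoint hz
    simp only [sub_self, mul_zero, add_zero] at hzi
    by_cases hzm : z = m
    · rw [hzm, div_self hma]
      exact Complex.one_mem_slitPlane
    · refine .inr fun h0 => ?_
      have := key z hzi
      rw [h0, zero_mul, eq_comm, mul_eq_zero] at this
      rcases this with h | h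
      · exact hzm (Complex.ext (by linarith) (by rw [hzi, hm]))
      · linarith
  have h2 := sub_eq_sub_of_exp_eq_mul_exp (convex_segment _ _).isPreconnected
      (hgc.mono subset_union_right) (g := fun z => Complex.log ((z - a) / (m - a)))
      (ContinuousOn.clog (by fun_prop) hslit) (c := (m - a)) (fun z hz => by
        rw [hge z (.inr hz), Complex.exp_log (Complex.slitPlane_ne_zero (hslit z hz))]
        field_simp) (left_mem_segment _ _ _) (right_mem_segment _ _ _)
  have hv := key (gridPoint (x, y)) rfl
  have hr := key (gridPoint (x + 1, y)) rfl
  simp only [gridPoint, hm] at hv hr h1 h2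
  push_cast at hv hr h1 h2
  have hv' : 0 < (((⟨x, y⟩ : ℂ) - a) / (⟨x + 1 / 2, y⟩ - a)).im := by
    refine pos_of_mul_pos_left ?_ (hm ▸ hnorm.le)
    rw [hv]
    nlinarith
  have hr' : (((⟨x + 1, y⟩ : ℂ) - a) / (⟨x + 1 / 2, y⟩ - a)).im < 0 := by
    refine neg_of_mul_neg_left ?_ (hm ▸ hnorm.le)
    rw [hr]
    nlinarith
  have h3 := congrArg Complex.im h1
  have h4 := congrArg Complex.im h2
  simp only [Complex.sub_im, Complex.log_im, Complex.arg_neg_eq_arg_sub_pi_of_im_pos hv',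
    Complex.arg_neg_eq_arg_add_pi_of_im_neg hr'] at h3 h4
  linarith [Real.pi_pos]

/-- The loop at `x₀` obtained from a path class by choosing, for each point, a path from `x₀`. -/
noncomputable def loopClass {X : Type*} [TopologicalSpace X] {x₀ : X}
    (c : ∀ x : X, Path.Homotopic.Quotient x₀ x) {x y : X} (q : Path.Homotopic.Quotient x y) :
    FundamentalGroup X x₀ :=
  FundamentalGroup.fromPath ((c x).trans (q.trans (c y).symm))

section loopClass

variable {X : Type*} [TopologicalSpace X] {x₀ : X} (c : ∀ x : X, Path.Homotopic.Quotient x₀ x)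

theorem loopClass_mul {x y z : X} (p : Path.Homotopic.Quotient x y)
    (q : Path.Homotopic.Quotient y z) :
    loopClass c q * loopClass c p = loopClass c (p.trans q) := by
  rw [FundamentalGroup.mul_def]
  change ((c x).trans (p.trans (c y).symm)).trans ((c y).trans (q.trans (c z).symm)) =
    (c x).trans ((p.trans q).trans (c z).symm)
  simp only [Path.Homotopic.Quotient.trans_assoc]
  rw [← Path.Homotopic.Quotient.trans_assoc (c y).symm, Path.Homotopic.Quotient.symm_trans,
    Path.Homotopic.Quotient.refl_trans]

theorem loopClass_refl (x : X) : loopClass c (Path.Homotopic.Quotient.refl x) = 1 := by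
  rw [FundamentalGroup.one_def]
  change (c x).trans ((Path.Homotopic.Quotient.refl x).trans (c x).symm) = _
  rw [Path.Homotopic.Quotient.refl_trans, Path.Homotopic.Quotient.trans_symm]

theorem eq_refl_of_loopClass_eq_one {q : Path.Homotopic.Quotient x₀ x₀} (h : loopClass c q = 1) :
    q = Path.Homotopic.Quotient.refl x₀ := by
  let u : FundamentalGroup X x₀ := FundamentalGroup.fromPath (c x₀)
  let v : FundamentalGroup X x₀ := FundamentalGroup.fromPath q
  have h' : u⁻¹ * v * u = 1 := by
    rw [← h, FundamentalGroup.mul_def, FundamentalGroup.mul_def]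
    rfl
  have : v = 1 := by
    rwa [mul_assoc, inv_mul_eq_one, eq_comm, mul_eq_right] at h'
  exact this

theorem loopClass_cast {x y x' y' : X} (γ : Path x y) (hx : x' = x) (hy : y' = y) :
    loopClass c (Path.Homotopic.Quotient.mk (γ.cast hx hy)) =
      loopClass c (Path.Homotopic.Quotient.mk γ) := by
  subst hx hy
  rfl

end loopClass

theorem Path.homotopic_of_convex {E : Type*} [AddCommGroup E] [Module ℝ E] [TopologicalSpace E]
    [ContinuousAdd E] [ContinuousSMul ℝ E] {U C : Set E} (hC : Convex ℝ C) (hCU : C ⊆ U)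
    {x y : U} (p q : Path x y) (hp : ∀ t, (p t : E) ∈ C) (hq : ∀ t, (q t : E) ∈ C) :
    p.Homotopic q := by
  have hx : (x : E) ∈ C := by simpa using hp 0
  have hy : (y : E) ∈ C := by simpa using hp 1
  have := hC.contractibleSpace ⟨_, hx⟩
  let lift : ∀ r : Path x y, (∀ t, (r t : E) ∈ C) → Path (⟨x, hx⟩ : C) ⟨y, hy⟩ := fun r hr =>
    { toFun := fun t => ⟨r t, hr t⟩
      continuous_toFun := by fun_prop
      source' := by simp
      target' := by simp }
  have := (SimplyConnectedSpace.paths_homotopic (lift p hp) (lift q hq)).map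
    ⟨inclusion hCU, continuous_inclusion hCU⟩
  exact this

theorem exists_path_of_segment_subset {U : Set ℂ} {z w : ℂ} (h : segment ℝ z w ⊆ U) :
    ∃ p : Path (⟨z, h (left_mem_segment ℝ z w)⟩ : U) ⟨w, h (right_mem_segment ℝ z w)⟩,
      ∀ t, (p t : ℂ) ∈ segment ℝ z w := by
  have := (convex_segment z w).isPathConnected ⟨z, left_mem_segment ℝ z w⟩
  obtain ⟨p, hp⟩ := this.joinedIn z (left_mem_segment ℝ z w) w (right_mem_segment ℝ z w)
  exact ⟨{ toFun := fun t => ⟨p t, h (hp t)⟩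
           continuous_toFun := by fun_prop
           source' := by simp
           target' := by simp }, hp⟩

/-- The fundamental group of a path-connected plane set is detected by a cocycle on segments. -/
theorem exists_segment_cocycle {U : Set ℂ} [PathConnectedSpace U] (x₀ : U) :
    ∃ a : ℂ → ℂ → FundamentalGroup U x₀,
      (∀ C ⊆ U, Convex ℝ C → ∀ z ∈ C, ∀ w ∈ C, ∀ r ∈ C, a w r * a z w = a z r) ∧
      ∀ γ : Path x₀ x₀, ∃ Φ : unitInterval → FundamentalGroup U x₀, Φ 0 = 1 ∧
        (Φ 1 = 1 → γ.Homotopic (Path.refl x₀)) ∧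
        ∀ t t', t ≤ t' → ∀ C ⊆ U, Convex ℝ C → (∀ s ∈ Icc t t', (γ s : ℂ) ∈ C) →
          Φ t' = a (γ t) (γ t') * Φ t := by
  classical
  let c : ∀ x : U, Path.Homotopic.Quotient x₀ x := fun x =>
    Path.Homotopic.Quotient.mk (PathConnectedSpace.somePath x₀ x)
  let a : ℂ → ℂ → FundamentalGroup U x₀ := fun z w =>
    if h : segment ℝ z w ⊆ U then
      loopClass c (Path.Homotopic.Quotient.mk (exists_path_of_segment_subset h).choose) else 1
  have ha : ∀ {C : Set ℂ}, C ⊆ U → Convex ℝ C → ∀ {x y : U} (p : Path x y), (∀ t, (p t : ℂ) ∈ C) →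
      a x y = loopClass c (Path.Homotopic.Quotient.mk p) := by
    intro C hCU hC x y p hp
    have hs : segment ℝ (x : ℂ) y ⊆ C :=
      hC.segment_subset (by simpa using hp 0) (by simpa using hp 1)
    have h := hs.trans hCU
    simp only [a, dif_pos h]
    congr 1
    exact Path.Homotopic.Quotient.eq.2 <| Path.homotopic_of_convex hC hCU _ _
      (fun t => hs ((exists_path_of_segment_subset h).choose_spec t)) hp
  refine ⟨a, ?_, fun γ => ⟨fun t => loopClass c (Path.Homotopic.Quotient.mk (γ.subpath 0 t)),
    ?_, fun h => ?_, ?_⟩⟩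
  · intro C hCU hC z hz w hw r hr
    have h1 := hC.segment_subset hz hw
    have h2 := hC.segment_subset hw hr
    obtain ⟨p, hp⟩ := exists_path_of_segment_subset (h1.trans hCU)
    obtain ⟨q, hq⟩ := exists_path_of_segment_subset (h2.trans hCU)
    have e1 := ha hCU hC p fun t => h1 (hp t)
    have e2 := ha hCU hC q fun t => h2 (hq t)
    have e3 := ha hCU hC (p.trans q) fun t => by
      rw [Path.trans_apply]
      split_ifs
      exacts [h1 (hp _), h2 (hq _)]
    simp only at e1 e2 e3
    rw [e1, e2, e3, loopClass_mul, Path.Homotopic.Quotient.mk_trans]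
  · simp only [Path.subpath_self]
    exact loopClass_refl c _
  · simp only [Path.subpath_zero_one, loopClass_cast] at h
    exact Path.Homotopic.Quotient.eq.1 (eq_refl_of_loopClass_eq_one c h)
  · intro t t' htt' C hCU hC hs
    have e := ha hCU hC (γ.subpath t t') fun s => by
      have : γ.subpath t t' s ∈ range (γ.subpath t t') := mem_range_self s
      rw [Path.range_subpath_of_le γ t t' htt'] at this
      obtain ⟨s', hs', h⟩ := this
      rw [← h]
      exact hs s' hs'
    simp only
    rw [e, loopClass_mul, ← Path.Homotopic.Quotient.mk_trans]
    congr 1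
    exact Path.Homotopic.Quotient.eq.2 ⟨(Path.Homotopy.subpathTransSubpath γ 0 t t').symm⟩

theorem HasLogOnCompacts.preimage_mul {U : Set ℂ} (hU : HasLogOnCompacts U) {δ : ℂ} (hδ : δ ≠ 0) :
    HasLogOnCompacts ((fun z => δ * z) ⁻¹' U) := by
  intro Γ hΓ hc a ha
  obtain ⟨g, hg, hge⟩ := hU ((fun z => δ * z) '' Γ) (image_subset_iff.2 hΓ)
    (hc.image (by fun_prop)) (δ * a) ha
  refine ⟨fun z => g (δ * z) - Complex.log δ,
    (hg.comp (by fun_prop) (mapsTo_image _ _)).sub continuousOn_const, fun z hz => ?_⟩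
  rw [Complex.exp_sub, hge _ (mem_image_of_mem _ hz), Complex.exp_log hδ, ← mul_sub,
    mul_div_cancel_left₀ _ hδ]

theorem convex_grid_square (x y : ℤ) :
    Convex ℝ {z : ℂ | (x : ℝ) ≤ z.re ∧ z.re ≤ x + 1 ∧ (y : ℝ) - 1 ≤ z.im ∧ z.im ≤ y} := by
  have h : {z : ℂ | (x : ℝ) ≤ z.re ∧ z.re ≤ x + 1 ∧ (y : ℝ) - 1 ≤ z.im ∧ z.im ≤ y} =
      Complex.reLm ⁻¹' Icc (x : ℝ) (x + 1) ∩ Complex.imLm ⁻¹' Icc ((y : ℝ) - 1) y := by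
    ext z
    simp [and_assoc]
  rw [h]
  exact ((convex_Icc _ _).linear_preimage _).inter ((convex_Icc _ _).linear_preimage _)

/-- A segment cocycle has trivial product over closed grid walks. -/
theorem walkProd_cocycle_eq_one {U : Set ℂ} (hU : HasLogOnCompacts U) {G : Type*} [Group G]
    {a : ℂ → ℂ → G}
    (ha : ∀ C ⊆ U, Convex ℝ C → ∀ z ∈ C, ∀ w ∈ C, ∀ r ∈ C, a w r * a z w = a z r)
    (x : ℤ × ℤ) (l : List (ℤ × ℤ)) (hE : List.IsChain (GridEdge U) (x :: l ++ [x])) :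
    walkProd (fun p q => a (gridPoint p) (gridPoint q)) (x :: l ++ [x]) = 1 := by
  have hself : ∀ z ∈ U, a z z = 1 := fun z hz =>
    mul_eq_left.1 (ha {z} (by simpa using hz) (convex_singleton z) z rfl z rfl z rfl)
  refine walkProd_closed_eq_one (fun p q h => h.symm) (fun p q h => h.1)
    (fun p h => hself _ (h.2 (left_mem_segment _ _ _))) (fun p q h => ?_)
    (fun x y h hr => ?_) x l hE
  · rw [ha _ h.2 (convex_segment _ _) _ (left_mem_segment _ _ _) _ (right_mem_segment _ _ _) _
      (left_mem_segment _ _ _)]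
    exact hself _ (h.2 (left_mem_segment _ _ _))
  · have hsq := fun z : ℂ => square_subset_of_reflTransGen hU h hr (a := z)
    set S := {z : ℂ | (x : ℝ) ≤ z.re ∧ z.re ≤ x + 1 ∧ (y : ℝ) - 1 ≤ z.im ∧ z.im ≤ y} with hS
    have hSU : S ⊆ U := fun z hz => hsq z hz.1 hz.2.1 hz.2.2.1 hz.2.2.2
    have hSc : Convex ℝ S := convex_grid_square x y
    have m1 : gridPoint (x, y) ∈ S := by simp [hS, gridPoint]
    have m2 : gridPoint (x + 1, y) ∈ S := by simp [hS, gridPoint]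
    have m3 : gridPoint (x, y - 1) ∈ S := by simp [hS, gridPoint]
    have m4 : gridPoint (x + 1, y - 1) ∈ S := by simp [hS, gridPoint]
    refine ⟨⟨by simp, (hSc.segment_subset m2 m4).trans hSU⟩,
      ⟨by simp, (hSc.segment_subset m3 m4).trans hSU⟩, ?_⟩
    rw [ha S hSU hSc _ m3 _ m1 _ m2, ha S hSU hSc _ m3 _ m4 _ m2]

/-- The grid point to the lower left of a point of the plane. -/
noncomputable def gridFloor (z : ℂ) : ℤ × ℤ := (⌊z.re⌋, ⌊z.im⌋)

theorem norm_lt_of_abs_re_im {z : ℂ} {r s : ℝ} (hr : |z.re| < r) (hs : |z.im| < s) : ‖z‖ < r + s :=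
  (Complex.norm_le_abs_re_add_abs_im z).trans_lt (add_lt_add hr hs)

theorem dist_gridFloor_lt (z : ℂ) : dist (gridPoint (gridFloor z)) z < 2 := by
  rw [← one_add_one_eq_two, dist_eq_norm, ← neg_sub, norm_neg]
  apply norm_lt_of_abs_re_im <;>
    simp only [gridPoint, gridFloor, Complex.sub_re, Complex.sub_im, Int.self_sub_floor] <;>
    rw [abs_of_nonneg (Int.fract_nonneg _)] <;> exact Int.fract_lt_one _

/-- Discretising a path which moves in small steps. -/
theorem exists_isChain_of_steps {U : Set ℂ} {G : Type*} [Group G] {a : ℂ → ℂ → G}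
    (ha : ∀ C ⊆ U, Convex ℝ C → ∀ z ∈ C, ∀ w ∈ C, ∀ r ∈ C, a w r * a z w = a z r)
    {z : ℕ → ℂ} {Φ : ℕ → G} {N : ℕ} (hball : ∀ n ≤ N, Metric.ball (z n) 4 ⊆ U)
    (hstep : ∀ n < N, dist (z (n + 1)) (z n) < 1)
    (hΦ₀ : Φ 0 = 1) (hΦ : ∀ n < N, Φ (n + 1) = a (z n) (z (n + 1)) * Φ n) :
    ∃ l, List.IsChain (GridEdge U) (gridFloor (z 0) :: l ++ [gridFloor (z N)]) ∧
      Φ N = a (gridPoint (gridFloor (z N))) (z N) *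
        walkProd (fun p q => a (gridPoint p) (gridPoint q))
          (gridFloor (z 0) :: l ++ [gridFloor (z N)]) * a (z 0) (gridPoint (gridFloor (z 0))) := by
  induction N with
  | zero =>
    have hU := hball 0 le_rfl
    have m0 : z 0 ∈ Metric.ball (z 0) 4 := Metric.mem_ball_self (by norm_num)
    have m1 : gridPoint (gridFloor (z 0)) ∈ Metric.ball (z 0) 4 :=
      Metric.mem_ball.2 ((dist_gridFloor_lt _).trans (by norm_num))
    have hc := convex_ball (z 0) 4
    refine ⟨[], by simp [GridEdge, hU m1], ?_⟩
    simp only [List.cons_append, List.nil_append, walkProd, one_mul]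
    rw [ha _ hU hc _ m1 _ m1 _ m0, ha _ hU hc _ m0 _ m1 _ m0, hΦ₀]
    exact (mul_eq_left.1 (ha _ hU hc _ m0 _ m0 _ m0)).symm
  | succ n ih =>
    obtain ⟨l, hl, hlΦ⟩ := ih (fun k hk => hball k (by omega)) (fun k hk => hstep k (by omega))
      (fun k hk => hΦ k (by omega))
    have hU := hball n (by omega)
    have hs := hstep n (by omega)
    have hc := convex_ball (z n) 4
    set k : ℤ × ℤ := ((gridFloor (z (n + 1))).1, (gridFloor (z n)).2) with hk
    have m0 : z n ∈ Metric.ball (z n) 4 := Metric.mem_ball_self (by norm_num)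
    have m1 : z (n + 1) ∈ Metric.ball (z n) 4 := Metric.mem_ball.2 (hs.trans (by norm_num))
    have m2 : gridPoint (gridFloor (z n)) ∈ Metric.ball (z n) 4 :=
      Metric.mem_ball.2 ((dist_gridFloor_lt _).trans (by norm_num))
    have m3 : gridPoint (gridFloor (z (n + 1))) ∈ Metric.ball (z n) 4 :=
      Metric.mem_ball.2 ((dist_triangle _ _ _).trans_lt
        ((add_lt_add (dist_gridFloor_lt _) hs).trans (by norm_num)))
    have hre : |(z (n + 1)).re - (z n).re| < 1 := by
      rw [dist_eq_norm] at hs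
      exact (Complex.abs_re_le_norm (z (n + 1) - z n)).trans_lt hs
    have him : |(z (n + 1)).im - (z n).im| < 1 := by
      rw [dist_eq_norm] at hs
      exact (Complex.abs_im_le_norm (z (n + 1) - z n)).trans_lt hs
    have f1 := Int.floor_le (z n).re
    have f2 := Int.lt_floor_add_one (z n).re
    have f3 := Int.floor_le (z n).im
    have f4 := Int.lt_floor_add_one (z n).im
    have f5 := Int.floor_le (z (n + 1)).re
    have f6 := Int.lt_floor_add_one (z (n + 1)).re
    rw [abs_lt] at hre
    have m4 : gridPoint k ∈ Metric.ball (z n) 4 := by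
      rw [Metric.mem_ball, dist_eq_norm, show (4 : ℝ) = 2 + 2 by norm_num]
      apply norm_lt_of_abs_re_im <;>
        simp only [hk, gridPoint, gridFloor, Complex.sub_re, Complex.sub_im] <;>
        rw [abs_lt] <;> constructor <;> linarith
    have e1 : GridEdge U (gridFloor (z n)) k := by
      refine ⟨?_, (hc.segment_subset m2 m4).trans hU⟩
      simp only [hk, gridFloor, sub_self, abs_zero, add_zero]
      rw [← Int.lt_add_one_iff, abs_lt]
      constructor
      · have : (⌊(z (n + 1)).re⌋ : ℝ) < ⌊(z n).re⌋ + 2 := by linarith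
        have : ⌊(z (n + 1)).re⌋ < ⌊(z n).re⌋ + 2 := by exact_mod_cast this
        omega
      · have : (⌊(z n).re⌋ : ℝ) < ⌊(z (n + 1)).re⌋ + 2 := by linarith
        have : ⌊(z n).re⌋ < ⌊(z (n + 1)).re⌋ + 2 := by exact_mod_cast this
        omega
    have e2 : GridEdge U k (gridFloor (z (n + 1))) := by
      refine ⟨?_, (hc.segment_subset m4 m3).trans hU⟩
      have f7 := Int.floor_le (z (n + 1)).im
      have f8 := Int.lt_floor_add_one (z (n + 1)).im
      rw [abs_lt] at him
      simp only [hk, gridFloor, sub_self, abs_zero, zero_add]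
      rw [← Int.lt_add_one_iff, abs_lt]
      constructor
      · have : (⌊(z (n + 1)).im⌋ : ℝ) < ⌊(z n).im⌋ + 2 := by linarith
        have : ⌊(z (n + 1)).im⌋ < ⌊(z n).im⌋ + 2 := by exact_mod_cast this
        omega
      · have : (⌊(z n).im⌋ : ℝ) < ⌊(z (n + 1)).im⌋ + 2 := by linarith
        have : ⌊(z n).im⌋ < ⌊(z (n + 1)).im⌋ + 2 := by exact_mod_cast this
        omega
    have e : gridFloor (z 0) :: (l ++ [gridFloor (z n), k]) ++ [gridFloor (z (n + 1))] =
        (gridFloor (z 0) :: l) ++ gridFloor (z n) :: [k, gridFloor (z (n + 1))] := by simp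
    refine ⟨l ++ [gridFloor (z n), k], ?_, ?_⟩
    · rw [e, List.isChain_split]
      exact ⟨hl, by simp [e1, e2]⟩
    · rw [e, walkProd_append, hΦ n (by omega), hlΦ]
      simp only [walkProd, one_mul]
      rw [ha _ hU hc _ m2 _ m4 _ m3, mul_assoc _ (walkProd _ _), ← mul_assoc (a (z n) _),
        ha _ hU hc _ m2 _ m0 _ m1, ← mul_assoc (a (gridPoint (gridFloor (z (n + 1)))) _),
        ha _ hU hc _ m2 _ m3 _ m1, mul_assoc]

theorem isSimplyConnected_of_hasLogOnCompacts {U : Set ℂ} (hUo : IsOpen U) (hUc : IsConnected U)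
    (hU : HasLogOnCompacts U) : IsSimplyConnected U := by
  have hpc := (hUo.isConnected_iff_isPathConnected).1 hUc
  have : PathConnectedSpace U := isPathConnected_iff_pathConnectedSpace.1 hpc
  refine (simply_connected_iff_loops_nullhomotopic (Y := U)).2 ⟨this, fun x₀ γ => ?_⟩
  obtain ⟨a, ha, hγ⟩ := exists_segment_cocycle x₀
  obtain ⟨Φ, hΦ₀, hΦ₁, hΦ⟩ := hγ γ
  refine hΦ₁ ?_
  -- a mesh size, and a subdivision of the loop
  have hcont : Continuous fun t => (γ t : ℂ) := by fun_prop
  obtain ⟨ε, hε, hεU⟩ := (isCompact_range hcont).exists_thickening_subset_open hUo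
    (range_subset_iff.2 fun t => (γ t).2)
  have hballU : ∀ t, Metric.ball (γ t : ℂ) ε ⊆ U := fun t =>
    (Metric.ball_subset_thickening (mem_range_self t) ε).trans hεU
  set δ : ℝ := ε / 4 with hδ
  have hδ0 : 0 < δ := by positivity
  have hδC : (δ : ℂ) ≠ 0 := by exact_mod_cast hδ0.ne'
  obtain ⟨η, hη, hηγ⟩ := Metric.uniformContinuous_iff.1
    (CompactSpace.uniformContinuous_of_continuous hcont) δ hδ0
  obtain ⟨N, hN⟩ := exists_nat_gt (1 / η)
  have hNpos : (0 : ℝ) < N := lt_trans (by positivity) hN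
  set t : ℕ → unitInterval := fun n => projIcc (0 : ℝ) 1 zero_le_one (n / N) with ht
  have ht0 : t 0 = 0 := by
    simp only [ht, Nat.cast_zero, zero_div]
    exact projIcc_left _
  have htN : t N = 1 := by
    simp only [ht, div_self hNpos.ne']
    exact projIcc_right _
  have hmono : ∀ n, t n ≤ t (n + 1) := fun n => monotone_projIcc _ (by gcongr; simp)
  have hsmall : ∀ n, ∀ s ∈ Icc (t n) (t (n + 1)), dist (γ s : ℂ) (γ (t n)) < δ := by
    intro n s hs
    refine hηγ ?_
    have h1 : dist (t (n + 1)) (t n) ≤ 1 / N := by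
      rw [Subtype.dist_eq, Real.dist_eq]
      refine (abs_projIcc_sub_projIcc (zero_le_one' ℝ)).trans_eq ?_
      rw [← sub_div, Nat.cast_succ, add_sub_cancel_left, abs_of_pos (by positivity)]
    have h2 : (1 : ℝ) / N < η := by
      rw [div_lt_comm₀ hNpos hη]
      exact hN
    refine lt_of_le_of_lt ?_ (h1.trans_lt h2)
    rw [Subtype.dist_eq, Subtype.dist_eq, Real.dist_eq, Real.dist_eq,
      abs_of_nonneg (sub_nonneg.2 (Subtype.coe_le_coe.2 hs.1)),
      abs_of_nonneg (sub_nonneg.2 (Subtype.coe_le_coe.2 (hmono n)))]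
    exact sub_le_sub_right (Subtype.coe_le_coe.2 hs.2) _
  set U' := (fun z => (δ : ℂ) * z) ⁻¹' U with hU'
  set a' : ℂ → ℂ → FundamentalGroup U x₀ := fun z w => a (δ * z) (δ * w) with ha'
  have hcoc : ∀ C ⊆ U', Convex ℝ C → ∀ z ∈ C, ∀ w ∈ C, ∀ r ∈ C, a' w r * a' z w = a' z r := by
    intro C hC hCc z hz w hw r hr
    exact ha ((fun z => (δ : ℂ) * z) '' C) (image_subset_iff.2 hC)
      (hCc.linear_image (LinearMap.mulLeft ℝ (δ : ℂ))) _ (mem_image_of_mem _ hz) _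
      (mem_image_of_mem _ hw) _ (mem_image_of_mem _ hr)
  have hmul : ∀ w : ℂ, (δ : ℂ) * (w / δ) = w := fun w => mul_div_cancel₀ _ hδC
  have hball : ∀ n, Metric.ball ((γ (t n) : ℂ) / δ) 4 ⊆ U' := fun n w hw => hballU (t n) (by
    rw [Metric.mem_ball, dist_eq_norm] at hw ⊢
    have : (δ : ℂ) * w - γ (t n) = δ * (w - γ (t n) / δ) := by rw [mul_sub, hmul]
    rw [this, norm_mul, Complex.norm_of_nonneg hδ0.le]
    nlinarith)
  obtain ⟨l, hl, hlΦ⟩ := exists_isChain_of_steps (U := U') hcoc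
    (z := fun n => (γ (t n) : ℂ) / δ) (Φ := fun n => Φ (t n)) (N := N)
    (fun n _ => hball n)
    (fun n _ => by
      rw [dist_eq_norm, ← sub_div, norm_div, Complex.norm_of_nonneg hδ0.le, div_lt_one hδ0,
        ← dist_eq_norm]
      exact hsmall n _ ⟨hmono n, le_rfl⟩)
    (by simpa only [ht0] using hΦ₀)
    (fun n _ => by
      simp only [ha', hmul]
      refine hΦ _ _ (hmono n) _ (hballU (t n)) (convex_ball _ _) fun s hs => ?_
      exact Metric.mem_ball.2 ((hsmall n s hs).trans (by rw [hδ]; linarith)))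
  have hclosed : γ (t N) = γ (t 0) := by rw [ht0, htN, γ.source, γ.target]
  simp only [hclosed] at hl hlΦ
  rw [walkProd_cocycle_eq_one (hU.preimage_mul hδC) hcoc _ _ hl, mul_one, htN] at hlΦ
  rw [hlΦ]
  have m0 := Metric.mem_ball_self (x := (γ (t 0) : ℂ) / δ) (by norm_num : (0 : ℝ) < 4)
  have hc := convex_ball ((γ (t 0) : ℂ) / δ) 4
  rw [hcoc _ (hball 0) hc _ m0 _
    (Metric.mem_ball.2 ((dist_gridFloor_lt _).trans (by norm_num))) _ m0]
  exact mul_eq_left.1 (hcoc _ (hball 0) hc _ m0 _ m0 _ m0)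

/-- Logarithms of `z - a` exist on compact subsets of `U` if the complement of `U` in the Riemann
sphere is connected. -/
theorem hasLogOnCompacts_of_isPreconnected_compl {U : Set ℂ}
    (hK : IsPreconnected (((↑) : ℂ → OnePoint ℂ) '' U)ᶜ) : HasLogOnCompacts U := by
  intro Γ hΓ hΓc a₀ ha₀
  set P : Set ℂ := {a | a ∉ Γ ∧ ∃ g : ℂ → ℂ, ContinuousOn g Γ ∧ ∀ z ∈ Γ, Complex.exp (g z) = z - a}
    with hP
  have hmove : ∀ a b, b ∈ P → (∀ z ∈ Γ, ‖a - b‖ < ‖z - b‖) → a ∈ P := by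
    rintro a b ⟨hb, g, hg, hge⟩ hab
    refine ⟨fun ha => lt_irrefl _ (hab a ha),
      fun z => g z + Complex.log (1 - (a - b) / (z - b)), ?_, fun z hz => ?_⟩
    · refine hg.add (ContinuousOn.clog (continuousOn_const.sub (continuousOn_const.div
        (by fun_prop) fun z hz => sub_ne_zero.2 ?_)) fun z hz => ?_)
      · rintro rfl
        exact hb hz
      · refine Complex.mem_slitPlane_of_norm_lt_one (z := -((a - b) / (z - b))) ?_
        rw [norm_neg, norm_div, div_lt_one ((norm_nonneg _).trans_lt (hab z hz))]
        exact hab z hz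
    · have hzb : z - b ≠ 0 := norm_pos_iff.1 ((norm_nonneg _).trans_lt (hab z hz))
      have : z - a ≠ 0 := by
        rw [sub_ne_zero]
        rintro rfl
        exact lt_irrefl _ (hab z hz)
      have h1 : 1 - (a - b) / (z - b) = (z - a) / (z - b) := by field_simp; ring
      rw [Complex.exp_add, hge z hz, h1, Complex.exp_log (div_ne_zero this hzb),
        mul_div_cancel₀ _ hzb]
  have hloc : ∀ a ∉ Γ, ∃ ε > 0, ∀ b ∈ Metric.ball a ε, b ∉ Γ ∧ (b ∈ P ↔ a ∈ P) := by
    intro a ha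
    obtain ⟨ε, hε, h⟩ := Metric.isOpen_iff.1 hΓc.isClosed.isOpen_compl a ha
    have hfar : ∀ z ∈ Γ, ε ≤ ‖z - a‖ := fun z hz => by
      by_contra! hlt
      exact h (by rwa [Metric.mem_ball, dist_eq_norm]) hz
    refine ⟨ε / 2, by positivity,
      fun b hb => ⟨h (Metric.ball_subset_ball (by linarith) hb), ?_, ?_⟩⟩
    all_goals
      rw [Metric.mem_ball, dist_eq_norm] at hb
      refine fun hbP => hmove _ _ hbP fun z hz => ?_
      have := hfar z hz
    · have h1 := norm_sub_le_norm_sub_add_norm_sub z b a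
      rw [norm_sub_rev] at hb
      rw [norm_sub_rev b a] at h1
      linarith
    · linarith
  have hPo : IsOpen P := Metric.isOpen_iff.2 fun a ha => by
    obtain ⟨ε, hε, h⟩ := hloc a ha.1
    exact ⟨ε, hε, fun b hb => (h b hb).2.2 ha⟩
  have hQo : IsOpen {a | a ∉ Γ ∧ a ∉ P} := Metric.isOpen_iff.2 fun a ha => by
    obtain ⟨ε, hε, h⟩ := hloc a ha.1
    exact ⟨ε, hε, fun b hb => ⟨(h b hb).1, fun hbP => ha.2 ((h b hb).2.1 hbP)⟩⟩
  have hPc : IsCompact Pᶜ := by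
    obtain ⟨R, hR⟩ := hΓc.isBounded.subset_ball 0
    refine (isCompact_closedBall (0 : ℂ) (max R 0)).of_isClosed_subset hPo.isClosed_compl
      fun a ha => ?_
    by_contra hlt
    rw [Metric.mem_closedBall, dist_zero_right, not_le, max_lt_iff] at hlt
    have hΓa : ∀ z ∈ Γ, ‖z‖ < ‖a‖ := fun z hz => by
      have := hR hz
      rw [Metric.mem_ball, dist_zero_right] at this
      exact this.trans hlt.1
    have ha0 : a ≠ 0 := norm_pos_iff.1 hlt.2
    have hslit : ∀ z ∈ Γ, 1 - z / a ∈ Complex.slitPlane := fun z hz => by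
      refine Complex.mem_slitPlane_of_norm_lt_one (z := -(z / a)) ?_
      rw [norm_neg, norm_div, div_lt_one hlt.2]
      exact hΓa z hz
    refine ha ⟨fun h => lt_irrefl _ (hΓa a h),
      fun z => Complex.log (-a) + Complex.log (1 - z / a), ?_, fun z hz => ?_⟩
    · exact continuousOn_const.add (ContinuousOn.clog (by fun_prop) hslit)
    · rw [Complex.exp_add, Complex.exp_log (neg_ne_zero.2 ha0),
        Complex.exp_log (Complex.slitPlane_ne_zero (hslit z hz))]
      field_simp
      ring
  have hmem : ∀ a ∉ U, a ∈ P ∨ a ∈ {a | a ∉ Γ ∧ a ∉ P} := fun a ha => by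
    by_cases h : a ∈ P
    exacts [.inl h, .inr ⟨fun h' => ha (hΓ h'), h⟩]
  have hsub := IsPreconnected.subset_left_of_subset_union
    (OnePoint.isOpen_compl_image_coe.2 ⟨hPo.isClosed_compl, hPc⟩) (OnePoint.isOpen_image_coe.2 hQo)
    (disjoint_compl_left.mono_right (image_mono fun a ha => ha.2)) (fun x hx => by
      induction x using OnePoint.rec with
      | infty => simp
      | coe a =>
        rcases hmem a (fun h => hx (mem_image_of_mem _ h)) with h | h
        · exact .inl (by simpa using h)
        · exact .inr (mem_image_of_mem _ h)) ⟨OnePoint.infty, by simp, by simp⟩ hK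
  have : (a₀ : OnePoint ℂ) ∈ (((↑) : ℂ → OnePoint ℂ) '' Pᶜ)ᶜ := hsub (by simpa using ha₀)
  have : a₀ ∈ P := by simpa using this
  exact this.2

theorem isSimplyConnected_univ_complex : IsSimplyConnected (univ : Set ℂ) := by
  have := (convex_univ (𝕜 := ℝ) (E := ℂ)).contractibleSpace ⟨0, trivial⟩
  exact inferInstanceAs (SimplyConnectedSpace (univ : Set ℂ))

/-- Janiszewski: two disjoint closed sets in the plane which do not separate it do not separate it
together. -/
theorem isPreconnected_compl_union {F₁ F₂ : Set ℂ} (h₁ : IsClosed F₁) (h₂ : IsClosed F₂)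
    (hd : Disjoint F₁ F₂) (hc₁ : IsPreconnected F₁ᶜ) (hc₂ : IsPreconnected F₂ᶜ) :
    IsPreconnected (F₁ ∪ F₂)ᶜ := by
  classical
  intro V W hV hW hcover ⟨v, hv⟩ ⟨w, hw⟩
  by_contra hempty
  have hD : ∀ z, z ∉ F₁ → z ∉ F₂ → z ∈ V → z ∉ W := fun z hz₁ hz₂ hzV hzW =>
    hempty ⟨z, by simp [hz₁, hz₂], hzV, hzW⟩
  set V' := (F₁ ∪ F₂)ᶜ ∩ V with hV'
  have hDo : IsOpen (F₁ ∪ F₂)ᶜ := (h₁.union h₂).isOpen_compl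
  have hfr : ∀ z ∈ frontier V', z ∈ F₁ ∨ z ∈ F₂ := by
    intro z hz
    by_contra h
    have hzD : z ∈ (F₁ ∪ F₂)ᶜ := h
    rw [(hDo.inter hV).frontier_eq] at hz
    rcases hcover hzD with hzV | hzW
    · exact hz.2 ⟨hzD, hzV⟩
    · obtain ⟨y, hy, hyV⟩ := mem_closure_iff.1 hz.1 _ (hDo.inter hW) ⟨hzD, hzW⟩
      exact hempty ⟨y, hy.1, hyV.2, hy.2⟩
  obtain ⟨φ, hφ₂, hφ₁, -⟩ := exists_continuous_zero_one_of_isClosed h₂ h₁ hd.symm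
  set k : ℂ := 2 * Real.pi * Complex.I with hk
  have hk0 : k ≠ 0 := Complex.two_pi_I_ne_zero
  set f : ℂ → ℂ := fun z => if z ∈ V' then k * φ z else 0 with hf
  set g : ℂ → ℂ := fun z => if z ∈ V' then k * (φ z - 1) else 0 with hg
  have hfc : ContinuousOn f F₁ᶜ := by
    refine ContinuousOn.if (fun z hz => ?_) (by fun_prop) continuousOn_const
    rw [hφ₂ ((hfr z hz.2).resolve_left hz.1)]
    simp
  have hgc : ContinuousOn g F₂ᶜ := by
    refine ContinuousOn.if (fun z hz => ?_) (by fun_prop) continuousOn_const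
    rw [hφ₁ ((hfr z hz.2).resolve_right hz.1)]
    simp
  have hfg : ∀ z, Complex.exp (f z) = Complex.exp (g z) := by
    intro z
    simp only [hf, hg]
    split_ifs
    · rw [mul_sub, mul_one, Complex.exp_sub, hk, Complex.exp_two_pi_mul_I, div_one]
    · rfl
  have hhc : Continuous fun z => Complex.exp (f z) := by
    rw [continuous_iff_continuousAt]
    intro z
    by_cases hz : z ∈ F₁
    · simp only [hfg]
      have := hgc.continuousAt (h₂.isOpen_compl.mem_nhds (disjoint_left.1 hd hz))
      exact Complex.continuous_exp.continuousAt.comp this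
    · have := hfc.continuousAt (h₁.isOpen_compl.mem_nhds hz)
      exact Complex.continuous_exp.continuousAt.comp this
  obtain ⟨θ, hθ, hθe⟩ := Complex.exists_continuousOn_eqOn_exp_comp isSimplyConnected_univ_complex
    isOpen_univ hhc.continuousOn (by rintro ⟨z, -, hz⟩; exact Complex.exp_ne_zero _ hz)
  have hθe' : ∀ z, Complex.exp (f z) = 1 * Complex.exp (θ z) := fun z => by
    rw [one_mul]; exact (hθe (mem_univ z)).symm
  have hv12 : v ∉ F₁ ∧ v ∉ F₂ := not_or.1 hv.1
  have hw12 : w ∉ F₁ ∧ w ∉ F₂ := not_or.1 hw.1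
  have e₁ := sub_eq_sub_of_exp_eq_mul_exp hc₁ hfc (hθ.mono (subset_univ _)) (fun z _ => hθe' z)
    hv12.1 hw12.1
  have e₂ := sub_eq_sub_of_exp_eq_mul_exp hc₂ hgc (hθ.mono (subset_univ _))
    (fun z _ => (hfg z).symm.trans (hθe' z)) hv12.2 hw12.2
  have hvV : v ∈ V' := hv
  have hwV : w ∉ V' := fun h => hD w hw12.1 hw12.2 h.2 hw.2
  simp only [hf, hg, if_pos hvV, if_neg hwV] at e₁ e₂
  apply hk0
  linear_combination e₁ - e₂

theorem isConnected_compl_union {F₁ F₂ : Set ℂ} (h₁ : IsClosed F₁) (h₂ : IsClosed F₂)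
    (hd : Disjoint F₁ F₂) (hc₁ : IsConnected F₁ᶜ) (hc₂ : IsConnected F₂ᶜ) :
    IsConnected (F₁ ∪ F₂)ᶜ := by
  refine ⟨?_, isPreconnected_compl_union h₁ h₂ hd hc₁.2 hc₂.2⟩
  by_contra hempty
  rw [not_nonempty_iff_eq_empty, compl_empty_iff] at hempty
  have hF : F₁ = F₂ᶜ := (isCompl_iff.2 ⟨hd, codisjoint_iff.2 hempty⟩).eq_compl
  have hclopen : IsClopen F₁ := ⟨h₁, hF ▸ h₂.isOpen_compl⟩
  rcases isClopen_iff.1 hclopen with h | h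
  · exact hc₂.nonempty.ne_empty (hF ▸ h)
  · exact hc₁.nonempty.ne_empty (by rw [h, compl_univ])

theorem isConnected_compl_biUnion {ι : Type*} {F : ι → Set ℂ} (hF : ∀ i, IsClosed (F i))
    (hd : Pairwise (Function.onFun Disjoint F)) (hc : ∀ i, IsConnected (F i)ᶜ) (s : Finset ι) :
    IsConnected (⋃ i ∈ s, F i)ᶜ := by
  classical
  induction s using Finset.induction_on with
  | empty => simpa using isConnected_univ
  | insert i s hi ih =>
    rw [Finset.set_biUnion_insert]
    refine isConnected_compl_union (hF i) (s.finite_toSet.isClosed_biUnion fun j _ => hF j) ?_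
      (hc i) ih
    rw [disjoint_iUnion₂_right]
    exact fun j hj => hd (by rintro rfl; exact hi hj)

/-- The Riemann sphere is homogeneous. -/
theorem exists_homeomorph_apply_eq_infty (q : OnePoint ℂ) :
    ∃ φ : OnePoint ℂ ≃ₜ OnePoint ℂ, φ q = OnePoint.infty := by
  classical
  induction q using OnePoint.rec with
  | infty => exact ⟨Homeomorph.refl _, rfl⟩
  | coe a =>
    let inv : OnePoint ℂ → OnePoint ℂ := fun x =>
      x.elim ((0 : ℂ) : OnePoint ℂ) fun z =>
        if z = 0 then OnePoint.infty else ((z⁻¹ : ℂ) : OnePoint ℂ)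
    have hinv : Function.Involutive inv := by
      intro x
      induction x using OnePoint.rec with
      | infty => simp [inv]
      | coe z =>
        by_cases hz : z = 0 <;> simp [inv, hz]
    have hcob : Filter.coclosedCompact ℂ = Bornology.cobounded ℂ := by
      rw [Filter.coclosedCompact_eq_cocompact, Metric.cobounded_eq_cocompact]
    have hcont : Continuous inv := by
      rw [OnePoint.continuous_iff]
      constructor
      · have h1 : Filter.Tendsto (fun z : ℂ => ((z⁻¹ : ℂ) : OnePoint ℂ)) (Bornology.cobounded ℂ)
            (nhds ((0 : ℂ) : OnePoint ℂ)) :=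
          OnePoint.continuous_coe.continuousAt.tendsto.comp Filter.tendsto_inv₀_cobounded
        rw [hcob]
        refine h1.congr' ?_
        filter_upwards [Bornology.eventually_ne_cobounded (0 : ℂ)] with z hz
        simp [inv, hz]
      · rw [continuous_iff_continuousAt]
        intro z
        by_cases hz : z = 0
        · subst hz
          rw [continuousAt_iff_punctured_nhds]
          have h1 : Filter.Tendsto (fun z : ℂ => ((z⁻¹ : ℂ) : OnePoint ℂ)) (nhdsWithin 0 {0}ᶜ)
              (nhds OnePoint.infty) :=
            OnePoint.tendsto_coe_infty.comp (hcob ▸ Filter.tendsto_inv₀_nhdsNE_zero)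
          have h2 : inv ((0 : ℂ) : OnePoint ℂ) = OnePoint.infty := by simp [inv]
          rw [h2]
          refine h1.congr' ?_
          filter_upwards [self_mem_nhdsWithin] with z hz
          have : z ≠ 0 := hz
          simp [inv, this]
        · have h1 : ContinuousAt (fun z : ℂ => ((z⁻¹ : ℂ) : OnePoint ℂ)) z :=
            OnePoint.continuous_coe.continuousAt.comp (continuousAt_inv₀ hz)
          refine h1.congr ?_
          filter_upwards [isOpen_ne.mem_nhds hz] with w hw
          have : w ≠ 0 := hw
          simp [inv, this]
    let ψ : OnePoint ℂ ≃ₜ OnePoint ℂ :=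
      { toEquiv := hinv.toPerm
        continuous_toFun := hcont
        continuous_invFun := hcont }
    refine ⟨((Homeomorph.subRight a).onePointCongr).trans ψ, ?_⟩
    change inv (((a - a : ℂ)) : OnePoint ℂ) = _
    simp [inv]

theorem union_at_infinity_nonseparating {ι : Type*} [Finite ι] [Nonempty ι]
    (C : ι → Set (OnePoint ℂ)) (hC : ∀ i, IsClosed (C i)) (hconn : ∀ i, IsConnected (C i))
    (hns : ∀ i, IsConnected (C i)ᶜ) (hmem : ∀ i, OnePoint.infty ∈ C i)
    (hinter : ∀ i j, i ≠ j → C i ∩ C j = {OnePoint.infty}) :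
    IsConnected (⋃ i, C i)ᶜ ∧ IsSimplyConnected (⋃ i, C i)ᶜ := by
  have hemb := OnePoint.isOpenEmbedding_coe (X := ℂ)
  have := Fintype.ofFinite ι
  set F : ι → Set ℂ := fun i => (↑) ⁻¹' C i with hF
  have hcl : ∀ i, IsClosed (F i) := fun i => (hC i).preimage hemb.continuous
  set U : Set ℂ := (⋃ i, F i)ᶜ with hU
  have hUconn : IsConnected U := by
    have := isConnected_compl_biUnion hcl (fun i j hij => ?_) (fun i => ?_) Finset.univ
    · simpa [hU] using this
    · rw [Function.onFun, disjoint_left]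
      intro z hi hj
      have : (z : OnePoint ℂ) ∈ C i ∩ C j := ⟨hi, hj⟩
      rw [hinter i j hij] at this
      exact OnePoint.coe_ne_infty z this
    · refine (hns i).preimage_of_isOpenMap hemb.injective hemb.isOpenMap fun x hx => ?_
      exact OnePoint.ne_infty_iff_exists.1 fun h => hx (h ▸ hmem i)
  have hUo : IsOpen U := (isClosed_iUnion_of_finite hcl).isOpen_compl
  have hUC : (⋃ i, C i)ᶜ = ((↑) : ℂ → OnePoint ℂ) '' U := by
    ext x
    induction x using OnePoint.rec with
    | infty => simp [hmem]
    | coe z => simp [hU, hF]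
  have hlog : HasLogOnCompacts U := hasLogOnCompacts_of_isPreconnected_compl <| by
    rw [← hUC, compl_compl]
    exact isPreconnected_iUnion ⟨OnePoint.infty, mem_iInter.2 hmem⟩ fun i => (hconn i).2
  rw [hUC]
  exact ⟨hUconn.image _ hemb.continuous.continuousOn,
    hemb.isEmbedding.isSimplyConnected_image.2
      (isSimplyConnected_of_hasLogOnCompacts hUo hUconn hlog)⟩

theorem union_at_common_point_nonseparating
    (n : ℕ) (hn : 1 ≤ n) (q : RSphere)
    (C : Fin n → Set RSphere)
    (hcont : ∀ i, IsContinuum (C i))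
    (hns : ∀ i, NonSeparating (C i))
    (hmem : ∀ i, q ∈ C i)
    (hinter : ∀ i j, i ≠ j → C i ∩ C j = {q}) :
    (⋃ i, C i)ᶜ.Nonempty ∧ IsConnected (⋃ i, C i)ᶜ ∧
      SimplyConnectedSpace ((⋃ i, C i)ᶜ : Set RSphere) := by
  have : Nonempty (Fin n) := ⟨⟨0, hn⟩⟩
  obtain ⟨φ, hφ⟩ := exists_homeomorph_apply_eq_infty q
  have h := union_at_infinity_nonseparating (fun i => φ '' C i)
    (fun i => φ.isClosed_image.2 (hcont i).2.1.isClosed)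
    (fun i => φ.isConnected_image.2 (hcont i).2.2)
    (fun i => by
      rw [← φ.image_compl]
      exact φ.isConnected_image.2 (hns i).2)
    (fun i => ⟨q, hmem i, hφ⟩)
    (fun i j hij => by rw [← image_inter φ.injective, hinter i j hij, image_singleton, hφ])
  rw [← image_iUnion, ← φ.image_compl, φ.isConnected_image, φ.isSimplyConnected_image] at h
  exact ⟨h.1.nonempty, h⟩
end

section
/- Let f be a transcendental entire function, let a ∈ ℂ, and let U ⊊ ℂ be a nonempty open connected simply connected set with a ∈ U and U ∩ S(f) ⊆ {a}. Let V be a connected component of f⁻¹(U). Then V is open, connected, and simply connected, and exactly one of the following holds: (1) there exist a natural number d ≥ 1 and holomorphic bijections ψ : V → 𝔻 and φ : U → 𝔻 onto the open unit disk 𝔻 such that φ(a) = 0 and φ(f(ψ⁻¹(z))) = z^d for all z ∈ 𝔻; (2) there exist a holomorphic bijection ψ : V → ℍ onto the left half-plane ℍ := {z ∈ ℂ : Re(z) < 0} and a holomorphic bijection φ : U → 𝔻 such that φ(a) = 0 and φ(f(ψ⁻¹(z))) = exp(z) for all z ∈ ℍ. -/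
open Metric Set

/-- `f` maps `U` homeomorphically onto `V`: there is a homeomorphism between the
subspaces `U` and `V` given by `f`. -/
def MapsHomeoOnto (f : ℂ → ℂ) (U V : Set ℂ) : Prop :=
  ∃ e : U ≃ₜ V, ∀ x : U, (e x : ℂ) = f x

/-- `a` is a singular value of `f`: there is no radius `r > 0` such that
`f ⁻¹ (D_r(a))` is a disjoint union of open sets, each of which `f` maps
homeomorphically onto `D_r(a)`. -/
def IsSingularValue (f : ℂ → ℂ) (a : ℂ) : Prop :=
  ¬ ∃ r : ℝ, 0 < r ∧ ∃ 𝒰 : Set (Set ℂ),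
      ⋃₀ 𝒰 = f ⁻¹' ball a r ∧ (∀ U ∈ 𝒰, IsOpen U) ∧
      𝒰.PairwiseDisjoint id ∧ ∀ U ∈ 𝒰, MapsHomeoOnto f U (ball a r)

/-- The post-singular set of `f`. -/
def postSingularSet (f : ℂ → ℂ) : Set ℂ :=
  closure (⋃ a ∈ {a | IsSingularValue f a}, ⋃ n : ℕ, {f^[n] a})

open Filter Topology ComplexConjugate

/-- A continuous branch `ψ` of an inverse of `P` along `g` is differentiable where `P' ≠ 0`. -/
theorem ContinuousAt.differentiableAt_of_comp_eq {P ψ g : ℂ → ℂ} {P' z : ℂ}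
    (hψ : ContinuousAt ψ z) (hP : HasStrictDerivAt P P' (ψ z)) (hP' : P' ≠ 0)
    (hg : DifferentiableAt ℂ g z) (h : ∀ᶠ w in 𝓝 z, P (ψ w) = g w) :
    DifferentiableAt ℂ ψ z := by
  have h1 : ∀ᶠ w in 𝓝 z, hP.localInverse P P' (ψ z) hP' (P (ψ w)) = ψ w :=
    hψ.eventually (hP.eventually_left_inverse hP')
  have h2 : HasStrictDerivAt (hP.localInverse P P' (ψ z) hP') P'⁻¹ (P (ψ z)) :=
    hP.to_localInverse hP'
  rw [h.self_of_nhds] at h2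
  refine (h2.hasDerivAt.differentiableAt.comp z hg).congr_of_eventuallyEq ?_
  filter_upwards [h1, h] with w hw hw'
  simp [← hw', hw]

/-- The Möbius transformation of the unit disk that sends `w` to `0`. -/
noncomputable def diskShift (w z : ℂ) : ℂ := (z - w) / (1 - conj w * z)

theorem one_sub_conj_mul_ne_zero {w z : ℂ} (hw : ‖w‖ < 1) (hz : ‖z‖ < 1) :
    1 - conj w * z ≠ 0 := by
  intro h
  have h1 : ‖conj w * z‖ = 1 := by rw [← sub_eq_zero.1 h]; simp
  rw [norm_mul, RCLike.norm_conj] at h1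
  nlinarith [norm_nonneg w, norm_nonneg z]

theorem norm_diskShift_lt_one {w z : ℂ} (hw : ‖w‖ < 1) (hz : ‖z‖ < 1) :
    ‖diskShift w z‖ < 1 := by
  have hne := one_sub_conj_mul_ne_zero hw hz
  rw [diskShift, norm_div, div_lt_one (norm_pos_iff.2 hne)]
  refine lt_of_pow_lt_pow_left₀ 2 (norm_nonneg _) ?_
  have hw2 : ‖w‖ ^ 2 < 1 := by nlinarith [norm_nonneg w]
  have hz2 : ‖z‖ ^ 2 < 1 := by nlinarith [norm_nonneg z]
  rw [Complex.sq_norm, Complex.normSq_apply] at hw2 hz2 ⊢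
  rw [Complex.sq_norm, Complex.normSq_apply]
  simp only [Complex.sub_re, Complex.sub_im, Complex.mul_re, Complex.mul_im, Complex.conj_re,
    Complex.conj_im, Complex.one_re, Complex.one_im]
  nlinarith [mul_pos (sub_pos.2 hw2) (sub_pos.2 hz2)]

@[simp] theorem diskShift_self (w : ℂ) : diskShift w w = 0 := by simp [diskShift]

theorem diskShift_neg_diskShift {w z : ℂ} (hw : ‖w‖ < 1) (hz : ‖z‖ < 1) :
    diskShift (-w) (diskShift w z) = z := by
  have h1 := one_sub_conj_mul_ne_zero hw hz
  have h3 : 1 - conj (-w) * diskShift w z ≠ 0 :=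
    one_sub_conj_mul_ne_zero (by simpa) (norm_diskShift_lt_one hw hz)
  have h4 : diskShift w z * (1 - conj w * z) = z - w := div_mul_cancel₀ _ h1
  rw [diskShift, div_eq_iff h3, map_neg]
  linear_combination h4

theorem diskShift_injOn {w : ℂ} (hw : ‖w‖ < 1) : InjOn (diskShift w) (ball 0 1) := by
  intro x hx y hy h
  rw [mem_ball_zero_iff] at hx hy
  rw [← diskShift_neg_diskShift hw hx, h, diskShift_neg_diskShift hw hy]

theorem differentiableAt_diskShift {w z : ℂ} (hw : ‖w‖ < 1) (hz : ‖z‖ < 1) :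
    DifferentiableAt ℂ (diskShift w) z := by
  unfold diskShift
  exact (by fun_prop : DifferentiableAt ℂ (fun z ↦ z - w) z).div (by fun_prop)
    (one_sub_conj_mul_ne_zero hw hz)

/-- The Koebe square root step in the proof of the Riemann mapping theorem. -/
theorem exists_norm_lt_of_notMem_image {U : Set ℂ} (hUo : IsOpen U) (hUc : IsSimplyConnected U)
    {F : ℂ → ℂ} (hF : DifferentiableOn ℂ F U) (hinj : InjOn F U) (hmaps : MapsTo F U (ball 0 1))
    {a b w : ℂ} (ha : a ∈ U) (hb : b ∈ U) (hab : a ≠ b) (hFa : F a = 0) (hw : ‖w‖ < 1)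
    (hwF : w ∉ F '' U) :
    ∃ G : ℂ → ℂ, DifferentiableOn ℂ G U ∧ InjOn G U ∧ MapsTo G U (ball 0 1) ∧ G a = 0 ∧
      ‖F b‖ < ‖G b‖ := by
  have hFn : ∀ z ∈ U, ‖F z‖ < 1 := fun z hz ↦ mem_ball_zero_iff.1 (hmaps hz)
  have hgd : ∀ z ∈ U, DifferentiableAt ℂ (fun z ↦ diskShift w (F z)) z := fun z hz ↦
    (differentiableAt_diskShift hw (hFn z hz)).comp z (hF.differentiableAt (hUo.mem_nhds hz))
  have hg0 : ∀ z ∈ U, diskShift w (F z) ≠ 0 := by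
    intro z hz h
    refine hwF ⟨z, hz, ?_⟩
    rw [← diskShift_neg_diskShift hw (hFn z hz), h]
    simp [diskShift]
  obtain ⟨S, hSc, hS⟩ := Complex.exists_continuousOn_pow_eq hUc hUo
    (g := fun z ↦ diskShift w (F z)) (fun z hz ↦ (hgd z hz).continuousAt.continuousWithinAt)
    (by rintro ⟨z, hz, h⟩; exact hg0 z hz h) two_ne_zero
  have hS0 : ∀ z ∈ U, S z ≠ 0 := by
    intro z hz h
    refine hg0 z hz ?_
    rw [← hS z, h]; simp
  have hSd : ∀ z ∈ U, DifferentiableAt ℂ S z := fun z hz ↦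
    (hSc.continuousAt (hUo.mem_nhds hz)).differentiableAt_of_comp_eq
      (P := fun x ↦ x ^ 2) (hasStrictDerivAt_pow 2 (S z)) (by simpa using hS0 z hz) (hgd z hz)
      (.of_forall hS)
  have hSn : ∀ z ∈ U, ‖S z‖ < 1 := by
    intro z hz
    have := norm_diskShift_lt_one hw (hFn z hz)
    rw [← hS z, norm_pow] at this
    nlinarith [norm_nonneg (S z)]
  have hSinj : InjOn S U := by
    intro x hx y hy h
    refine hinj hx hy (diskShift_injOn hw (hmaps hx) (hmaps hy) ?_)
    simp only [← hS, h]
  have hGinj : InjOn (fun z ↦ diskShift (S a) (S z)) U := by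
    intro x hx y hy h
    exact hSinj hx hy (diskShift_injOn (hSn a ha) (by simpa using hSn x hx)
      (by simpa using hSn y hy) h)
  refine ⟨fun z ↦ diskShift (S a) (S z), fun z hz ↦
    ((differentiableAt_diskShift (hSn a ha) (hSn z hz)).comp z
      (hSd z hz)).differentiableWithinAt, hGinj,
    fun z hz ↦ by simpa using norm_diskShift_lt_one (hSn a ha) (hSn z hz), by simp, ?_⟩
  have hw' : -w = S a ^ 2 := by rw [hS a, hFa]; simp [diskShift]
  have hGb : diskShift (S a) (S b) ≠ 0 := fun h ↦ hab (hGinj ha hb (by simp [h]))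
  have key : F b = diskShift (S a) (S b) * diskShift (-S a) (S b) := by
    rw [← diskShift_neg_diskShift hw (hFn b hb), hw', ← hS b]
    have h1 := one_sub_conj_mul_ne_zero (hSn a ha) (hSn b hb)
    have h2 : 1 - conj (-S a) * S b ≠ 0 :=
      one_sub_conj_mul_ne_zero (by simpa using hSn a ha) (hSn b hb)
    have h3 : 1 - conj (S a ^ 2) * S b ^ 2 = (1 - conj (S a) * S b) * (1 - conj (-S a) * S b) := by
      simp only [map_pow, map_neg]; ring
    simp only [diskShift]
    rw [h3]
    field_simp
    ring
  rw [key, norm_mul]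
  exact mul_lt_of_lt_one_right (norm_pos_iff.2 hGb)
    (norm_diskShift_lt_one (by simpa using hSn a ha) (hSn b hb))

/-- Hurwitz's theorem: a nonconstant locally uniform limit of injective holomorphic functions on a
connected open set is injective. -/
theorem TendstoLocallyUniformlyOn.injOn_of_injOn {ι : Type*} {l : Filter ι} [l.NeBot]
    {F : ι → ℂ → ℂ} {f : ℂ → ℂ} {U : Set ℂ} (hf : TendstoLocallyUniformlyOn F f l U)
    (hUo : IsOpen U) (hUc : IsPreconnected U) (hF : ∀ n, DifferentiableOn ℂ (F n) U)
    (hinj : ∀ n, InjOn (F n) U) (hne : ∃ a ∈ U, ∃ b ∈ U, f a ≠ f b) : InjOn f U := by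
  have hfd : DifferentiableOn ℂ f U := hf.differentiableOn (.of_forall hF) hUo
  intro x hx y hy hxy
  by_contra hxy'
  have hfa : AnalyticOnNhd ℂ f U := hfd.analyticOnNhd hUo
  have hisol : ∀ᶠ z in 𝓝[≠] x, f z ≠ f y := by
    rcases (hfa x hx).eventually_eq_or_eventually_ne (analyticAt_const (v := f y)) with h | h
    · obtain ⟨a, ha, b, hb, hab⟩ := hne
      have := hfa.eqOn_of_preconnected_of_eventuallyEq analyticOnNhd_const hUc hx h
      exact absurd ((this ha).trans (this hb).symm) hab
    · exact h
  rw [eventually_nhdsWithin_iff] at hisol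
  obtain ⟨r, hr, hrs⟩ := Metric.nhds_basis_closedBall.eventually_iff.1
    (hisol.and ((hUo.eventually_mem hx).and (isOpen_ne.eventually_mem hxy')))
  have hsub : closedBall x r ⊆ U := fun z hz ↦ (hrs hz).2.1
  obtain ⟨z₀, hz₀, hmin⟩ := (isCompact_sphere x r).exists_isMinOn
    (NormedSpace.sphere_nonempty.2 hr.le) (f := fun z ↦ ‖f z - f y‖)
    ((hfd.continuousOn.mono (sphere_subset_closedBall.trans hsub)).sub continuousOn_const).norm
  set m := ‖f z₀ - f y‖ with hm
  have hz₀x : z₀ ≠ x := ne_of_mem_sphere hz₀ hr.ne'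
  have hm0 : 0 < m :=
    norm_pos_iff.2 (sub_ne_zero.2 ((hrs (sphere_subset_closedBall hz₀)).1 hz₀x))
  have hunif := (tendstoLocallyUniformlyOn_iff_forall_isCompact hUo).1 hf
  have h1 := Metric.tendstoUniformlyOn_iff.1 (hunif _ hsub (isCompact_closedBall x r)) (m / 8)
    (by positivity)
  have h2 := Metric.tendstoUniformlyOn_iff.1
    (hunif {y} (singleton_subset_iff.2 hy) isCompact_singleton) (m / 8) (by positivity)
  obtain ⟨n, hn1, hn2⟩ := (h1.and h2).exists
  have hny := hn2 y rfl
  have hnx := hn1 x (mem_closedBall_self hr.le)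
  rw [hxy] at hnx
  have hfreq : ∃ᶠ z in 𝓝 x, F n z ≠ F n x := by
    have : ∀ᶠ z in 𝓝[≠] x, F n z ≠ F n x := by
      filter_upwards [self_mem_nhdsWithin, nhdsWithin_le_nhds (hUo.mem_nhds hx)] with z hzx hzU h
      exact hzx (hinj n hzU hx h)
    exact this.frequently.filter_mono nhdsWithin_le_nhds
  have hball := (((hF n).mono hsub).diffContOnCl_ball subset_rfl).ball_subset_image_closedBall
    (ε := 3 * m / 4) hr (fun z hz ↦ by
      have h3 : m ≤ ‖f z - f y‖ := hmin hz
      have h4 := hn1 z (sphere_subset_closedBall hz)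
      rw [← dist_eq_norm] at h3 ⊢
      linarith [dist_triangle (f z) (F n z) (f y), dist_triangle (F n z) (F n x) (f y),
        dist_comm (f y) (F n x)]) hfreq
  obtain ⟨z, hz, hzy⟩ := hball (show F n y ∈ ball (F n x) _ by
    rw [mem_ball]
    linarith [dist_triangle (F n y) (f y) (F n x), dist_comm (F n y) (f y)])
  exact (hrs hz).2.2 (hinj n (hsub hz) hy hzy)

/-- Pointwise limits of holomorphic maps into the unit disk are locally uniform. -/
theorem tendstoLocallyUniformlyOn_of_mapsTo_ball {ι : Type*} {l : Filter ι} [l.NeBot]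
    {F : ι → ℂ → ℂ} {f : ℂ → ℂ} {U : Set ℂ} (hUo : IsOpen U)
    (hF : ∀ n, DifferentiableOn ℂ (F n) U) (hmaps : ∀ n, MapsTo (F n) U (ball 0 1))
    (h : ∀ z ∈ U, Tendsto (fun n ↦ F n z) l (𝓝 (f z))) :
    TendstoLocallyUniformlyOn F f l U := by
  rw [Metric.tendstoLocallyUniformlyOn_iff]
  intro ε hε x hx
  obtain ⟨r, hr, hrU⟩ := Metric.isOpen_iff.1 hUo x hx
  have hlip : ∀ n, ∀ z ∈ ball x r, dist (F n z) (F n x) ≤ 2 / r * dist z x := by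
    intro n z hz
    refine Complex.dist_le_div_mul_dist_of_mapsTo_ball ((hF n).mono hrU) (fun y hy ↦ ?_) hz
    have h1 := mem_ball.1 (hmaps n (hrU hy))
    have h2 := mem_ball'.1 (hmaps n hx)
    rw [mem_closedBall]
    linarith [dist_triangle (F n y) 0 (F n x)]
  have hlip' : ∀ z ∈ ball x r, dist (f z) (f x) ≤ 2 / r * dist z x := fun z hz ↦
    le_of_tendsto ((h z (hrU hz)).dist (h x hx)) (.of_forall fun n ↦ hlip n z hz)
  set δ := min r (r / 2 * (ε / 3)) with hδ
  have hδ0 : 0 < δ := lt_min hr (by positivity)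
  have hsmall : ∀ z ∈ ball x δ, 2 / r * dist z x < ε / 3 := by
    intro z hz
    have : dist z x < r / 2 * (ε / 3) := (mem_ball.1 hz).trans_le (min_le_right _ _)
    calc 2 / r * dist z x < 2 / r * (r / 2 * (ε / 3)) := by gcongr
      _ = ε / 3 := by field_simp
  refine ⟨ball x δ, mem_nhdsWithin_of_mem_nhds (ball_mem_nhds x hδ0), ?_⟩
  filter_upwards [Metric.tendsto_nhds.1 (h x hx) (ε / 3) (by positivity)] with n hn z hz
  have hz' : z ∈ ball x r := ball_subset_ball (min_le_left _ _) hz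
  have h1 := (hlip n z hz').trans_lt (hsmall z hz)
  have h2 := (hlip' z hz').trans_lt (hsmall z hz)
  linarith [dist_triangle (f z) (f x) (F n z), dist_triangle (f x) (F n x) (F n z),
    dist_comm (f x) (F n x), dist_comm (F n x) (F n z)]

theorem mapsTo_ball_of_mapsTo_closedBall {f : ℂ → ℂ} {U : Set ℂ} (hUo : IsOpen U)
    (hUc : IsPreconnected U) (hf : DifferentiableOn ℂ f U) (hmaps : MapsTo f U (closedBall 0 1))
    {a : ℂ} (ha : a ∈ U) (hfa : ‖f a‖ < 1) : MapsTo f U (ball 0 1) := by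
  intro z hz
  have hz1 := mem_closedBall_zero_iff.1 (hmaps hz)
  rw [mem_ball_zero_iff]
  refine lt_of_le_of_ne hz1 fun h1 ↦ ?_
  have hmax : IsMaxOn (norm ∘ f) U z := fun y hy ↦ by
    simpa [h1] using hmaps hy
  have := Complex.norm_eqOn_of_isPreconnected_of_isMaxOn hUc hUo hf hz hmax ha
  simp only [Function.comp_apply, Function.const_apply] at this
  linarith

theorem exists_mapsTo_ball_injOn {U : Set ℂ} (hUo : IsOpen U) (hUc : IsSimplyConnected U)
    (hU : U ≠ univ) :
    ∃ F : ℂ → ℂ, MapsTo F U (ball 0 1) ∧ InjOn F U ∧ DifferentiableOn ℂ F U := by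
  obtain ⟨c, hc⟩ := (ne_univ_iff_exists_notMem U).1 hU
  have hcU : ∀ z ∈ U, z - c ≠ 0 := fun z hz ↦ sub_ne_zero.2 (ne_of_mem_of_not_mem hz hc)
  obtain ⟨s, hs, hsq⟩ := Complex.exists_continuousOn_pow_eq hUc hUo (g := fun z ↦ z - c)
    (by fun_prop) (by rintro ⟨z, hz, h⟩; exact hcU z hz h) two_ne_zero
  have hs0 : ∀ z ∈ U, s z ≠ 0 := fun z hz h ↦ hcU z hz (by rw [← hsq z, h]; simp)
  have hinj : ∀ z w, s z ^ 2 = s w ^ 2 → z = w := fun z w h ↦ by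
    rw [hsq, hsq] at h
    exact sub_left_injective h
  have hsd : ∀ z ∈ U, HasStrictDerivAt s (2 * s z)⁻¹ z := fun z hz ↦ by
    refine HasStrictDerivAt.of_local_left_inverse (f := fun w ↦ w ^ 2 + c)
      (hs.continuousAt (hUo.mem_nhds hz)) ?_ (by simpa using hs0 z hz)
      (.of_forall fun w ↦ by simp [hsq])
    simpa using (hasStrictDerivAt_pow 2 (s z)).add_const c
  obtain ⟨x, hx⟩ := hUc.nonempty
  have himg : s '' U ∈ 𝓝 (s x) := by
    rw [← (hsd x hx).map_nhds_eq (by simpa using hs0 x hx)]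
    exact Filter.image_mem_map (hUo.mem_nhds hx)
  obtain ⟨ε, hε, hεs⟩ := Metric.nhds_basis_closedBall.mem_iff.1 himg
  have hfar : ∀ z ∈ U, ε < ‖s z + s x‖ := by
    intro z hz
    by_contra! h
    obtain ⟨w, hw, hwz⟩ := hεs (show -s z ∈ closedBall (s x) ε by
      rwa [mem_closedBall, dist_eq_norm, ← norm_neg, neg_sub, sub_neg_eq_add, add_comm])
    obtain rfl := hinj w z (by rw [hwz, neg_sq])
    exact hs0 w hw (by linear_combination hwz / 2)
  have hne : ∀ z ∈ U, s z + s x ≠ 0 := fun z hz ↦ norm_pos_iff.1 (hε.trans (hfar z hz))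
  refine ⟨fun z ↦ ε / (s z + s x), fun z hz ↦ ?_, fun z hz w hw h ↦ ?_, fun z hz ↦ ?_⟩
  · rw [mem_ball_zero_iff, norm_div, Complex.norm_real, Real.norm_of_nonneg hε.le,
      div_lt_one (hε.trans (hfar z hz))]
    exact hfar z hz
  · have h' : s z = s w := by simpa [div_eq_mul_inv, hε.ne'] using h
    exact hinj z w (by rw [h'])
  · exact ((differentiableAt_const _).div ((hsd z hz).hasDerivAt.differentiableAt.add_const _)
      (hne z hz)).differentiableWithinAt

/-- The **Riemann mapping theorem**. -/
theorem exists_differentiableOn_bijOn_ball {U : Set ℂ} (hUo : IsOpen U)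
    (hUc : IsSimplyConnected U) (hU : U ≠ univ) {a : ℂ} (ha : a ∈ U) :
    ∃ φ : ℂ → ℂ, DifferentiableOn ℂ φ U ∧ BijOn φ U (ball 0 1) ∧ φ a = 0 := by
  have hpre : IsPreconnected U := hUc.isPathConnected.isConnected.isPreconnected
  obtain ⟨b, hb, hba⟩ : ∃ b ∈ U, b ≠ a := by
    have : ∀ᶠ z in 𝓝[≠] a, z ∈ U ∧ z ≠ a :=
      (eventually_nhdsWithin_of_eventually_nhds (hUo.mem_nhds ha)).and self_mem_nhdsWithin
    exact this.exists
  let 𝓕 : Set (ℂ → ℂ) :=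
    {F | DifferentiableOn ℂ F U ∧ InjOn F U ∧ MapsTo F U (ball 0 1) ∧ F a = 0}
  have hne : 𝓕.Nonempty := by
    obtain ⟨F, hmaps, hinj, hF⟩ := exists_mapsTo_ball_injOn hUo hUc hU
    have hFa : ‖F a‖ < 1 := mem_ball_zero_iff.1 (hmaps ha)
    have hFn : ∀ z ∈ U, ‖F z‖ < 1 := fun z hz ↦ mem_ball_zero_iff.1 (hmaps hz)
    refine ⟨fun z ↦ diskShift (F a) (F z), fun z hz ↦
      ((differentiableAt_diskShift hFa (hFn z hz)).comp z
        (hF.differentiableAt (hUo.mem_nhds hz))).differentiableWithinAt,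
      fun x hx y hy h ↦ hinj hx hy (diskShift_injOn hFa (hmaps hx) (hmaps hy) h),
      fun z hz ↦ by simpa using norm_diskShift_lt_one hFa (hFn z hz), by simp⟩
  let S : Set ℝ := (fun F : ℂ → ℂ ↦ ‖F b‖) '' 𝓕
  have hSb : BddAbove S := ⟨1, by
    rintro _ ⟨F, hF, rfl⟩
    exact (mem_ball_zero_iff.1 (hF.2.2.1 hb)).le⟩
  obtain ⟨u, -, hu, huS⟩ := exists_seq_tendsto_sSup (hne.image _) hSb
  choose F hF hFu using huS
  have hFnorm : ∀ n, ∀ z ∈ U, F n z ∈ closedBall (0 : ℂ) 1 := fun n z hz ↦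
    ball_subset_closedBall ((hF n).2.2.1 hz)
  let 𝒰 : Ultrafilter ℕ := .of atTop
  have hlim : ∀ z ∈ U, ∃ y ∈ closedBall (0 : ℂ) 1, Tendsto (fun n ↦ F n z) 𝒰 (𝓝 y) := by
    intro z hz
    obtain ⟨y, hy, hy'⟩ := (isCompact_closedBall (0 : ℂ) 1).ultrafilter_le_nhds
      (𝒰.map fun n ↦ F n z) (by
        rw [le_principal_iff]
        exact Filter.mem_map.2 (univ_mem' fun n ↦ hFnorm n z hz))
    exact ⟨y, hy, hy'⟩
  choose! φ hφmem hφ using hlim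
  have hloc : TendstoLocallyUniformlyOn F φ (𝒰 : Filter ℕ) U :=
    tendstoLocallyUniformlyOn_of_mapsTo_ball hUo (fun n ↦ (hF n).1) (fun n ↦ (hF n).2.2.1) hφ
  have hφd : DifferentiableOn ℂ φ U := hloc.differentiableOn (.of_forall fun n ↦ (hF n).1) hUo
  have hφa : φ a = 0 := tendsto_nhds_unique (hφ a ha) (by simp [(hF _).2.2.2])
  have hφb : ‖φ b‖ = sSup S := by
    refine tendsto_nhds_unique (hφ b hb).norm ?_
    have : Tendsto u (𝒰 : Filter ℕ) (𝓝 (sSup S)) := hu.mono_left (Ultrafilter.of_le _)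
    simpa only [hFu] using this
  have hpos : 0 < ‖φ b‖ := by
    obtain ⟨G, hG⟩ := hne
    rw [hφb]
    refine lt_of_lt_of_le (norm_pos_iff.2 fun h ↦ hba ?_) (le_csSup hSb ⟨G, hG, rfl⟩)
    exact hG.2.1 hb ha (h.trans hG.2.2.2.symm)
  have hφinj : InjOn φ U := hloc.injOn_of_injOn hUo hpre (fun n ↦ (hF n).1)
    (fun n ↦ (hF n).2.1) ⟨b, hb, a, ha, by rw [hφa]; exact norm_pos_iff.1 hpos⟩
  have hφmaps : MapsTo φ U (ball 0 1) :=
    mapsTo_ball_of_mapsTo_closedBall hUo hpre hφd hφmem ha (by simp [hφa])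
  refine ⟨φ, hφd, ⟨hφmaps, hφinj, fun w hw ↦ ?_⟩, hφa⟩
  by_contra hwim
  obtain ⟨G, hGd, hGi, hGm, hGa, hlt⟩ := exists_norm_lt_of_notMem_image hUo hUc hφd hφinj hφmaps
    ha hb hba.symm hφa (mem_ball_zero_iff.1 hw) hwim
  have := le_csSup hSb ⟨G, ⟨hGd, hGi, hGm, hGa⟩, rfl⟩
  rw [hφb] at hlt
  exact absurd hlt (not_lt.2 this)

theorem isCoveringMapOn_of_not_isSingularValue {f : ℂ → ℂ} {s : Set ℂ} (hf : Continuous f)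
    (h : ∀ w ∈ s, ¬ IsSingularValue f w) : IsCoveringMapOn f s := by
  intro x hx
  obtain ⟨r, hr, 𝒰, hU, hUo, hUd, hUh⟩ := not_not.1 (h x hx)
  choose e he using fun i : 𝒰 ↦ hUh i i.2
  let _ : TopologicalSpace 𝒰 := ⊥
  have : DiscreteTopology 𝒰 := ⟨rfl⟩
  have hidx : ∀ z : f ⁻¹' ball x r, ∃ i : 𝒰, (z : ℂ) ∈ (i : Set ℂ) := fun z ↦ by
    obtain ⟨i, hi, hz⟩ := hU.ge z.2
    exact ⟨⟨i, hi⟩, hz⟩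
  choose idx hidx using hidx
  have hidxu : ∀ (z : f ⁻¹' ball x r) (i : 𝒰), (z : ℂ) ∈ (i : Set ℂ) → idx z = i := fun z i hz ↦ by
    by_contra hne
    exact (disjoint_left.1 (hUd (idx z).2 i.2 (fun h ↦ hne (Subtype.ext h))) (hidx z)) hz
  have hidxc : Continuous idx := continuous_discrete_rng.2 fun i ↦ by
    have : idx ⁻¹' {i} = Subtype.val ⁻¹' (i : Set ℂ) := by
      ext z
      exact ⟨fun h ↦ by rw [← (show idx z = i from h)]; exact hidx z, fun h ↦ hidxu z i h⟩
    rw [this]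
    exact (hUo i i.2).preimage continuous_subtype_val
  have hmem : ∀ (p : ball x r × 𝒰), ((e p.2).symm p.1 : ℂ) ∈ f ⁻¹' ball x r := fun p ↦
    hU.le ⟨p.2, p.2.2, ((e p.2).symm p.1).2⟩
  have hfe : ∀ (p : ball x r × 𝒰), f ((e p.2).symm p.1 : ℂ) = p.1 := fun p ↦ by
    rw [← he, Homeomorph.apply_symm_apply]
  let H : f ⁻¹' ball x r ≃ₜ ball x r × 𝒰 :=
    { toFun z := (⟨f z, z.2⟩, idx z)
      invFun p := ⟨(e p.2).symm p.1, hmem p⟩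
      left_inv z := by
        apply Subtype.ext
        have : (⟨f z, z.2⟩ : ball x r) = e (idx z) ⟨z, hidx z⟩ :=
          Subtype.ext (he (idx z) ⟨z, hidx z⟩).symm
        simp only [this, Homeomorph.symm_apply_apply]
      right_inv p := Prod.ext (Subtype.ext (hfe p)) (hidxu _ _ ((e p.2).symm p.1).2)
      continuous_toFun := (Continuous.subtype_mk (by fun_prop) _).prodMk hidxc
      continuous_invFun := Continuous.subtype_mk (continuous_prod_of_discrete_right.2 fun i ↦
        continuous_subtype_val.comp (e i).symm.continuous) _ }
  exact (show IsEvenlyCovered f x 𝒰 from ⟨inferInstance, ball x r, mem_ball_self hr, isOpen_ball,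
    isOpen_ball.preimage hf, H, fun _ ↦ rfl⟩).to_isEvenlyCovered_preimage

section Lifts

variable {X E B : Type*} [TopologicalSpace X] [TopologicalSpace E] [TopologicalSpace B]
  {p : E → B} {t : Set B} {s : Set X}

theorem IsCoveringMapOn.eqOn_of_comp_eqOn (hp : IsCoveringMapOn p t) (hs : IsPreconnected s)
    {g₁ g₂ : X → E} (h₁ : ContinuousOn g₁ s) (h₂ : ContinuousOn g₂ s)
    (hmaps : ∀ x ∈ s, p (g₁ x) ∈ t) (he : ∀ x ∈ s, p (g₁ x) = p (g₂ x)) {x₀ : X} (hx₀ : x₀ ∈ s)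
    (h₀ : g₁ x₀ = g₂ x₀) : EqOn g₁ g₂ s := by
  have := isPreconnected_iff_preconnectedSpace.1 hs
  have hm₁ : ∀ x : s, g₁ x ∈ p ⁻¹' t := fun x ↦ hmaps x x.2
  have hm₂ : ∀ x : s, g₂ x ∈ p ⁻¹' t := fun x ↦ by
    rw [mem_preimage, ← he x x.2]
    exact hmaps x x.2
  have key := hp.isCoveringMap_restrictPreimage.eq_of_comp_eq
    (g₁ := fun x : s ↦ ⟨g₁ x, hm₁ x⟩) (g₂ := fun x : s ↦ ⟨g₂ x, hm₂ x⟩)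
    (Continuous.subtype_mk (continuousOn_iff_continuous_domRestrict.1 h₁) _)
    (Continuous.subtype_mk (continuousOn_iff_continuous_domRestrict.1 h₂) _)
    (funext fun x ↦ Subtype.ext (he x x.2)) ⟨x₀, hx₀⟩ (Subtype.ext h₀)
  exact fun x hx ↦ congrArg Subtype.val (congrFun key ⟨x, hx⟩)

theorem IsCoveringMapOn.exists_lift [LocallyPathConnectedSpace X] (hp : IsCoveringMapOn p t)
    (hso : IsOpen s) (hs : IsSimplyConnected s) {g : X → B} (hg : ContinuousOn g s)
    (hmaps : MapsTo g s t) {x₀ : X} (hx₀ : x₀ ∈ s) {e₀ : E} (he : p e₀ = g x₀) :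
    ∃ h : X → E, ContinuousOn h s ∧ h x₀ = e₀ ∧ ∀ x ∈ s, p (h x) = g x := by
  classical
  have := hs.simplyConnectedSpace
  have := hso.locallyPathConnectedSpace
  obtain ⟨F, ⟨hF0, hF⟩, -⟩ := hp.existsUnique_continuousMap_lifts
    ⟨s.domRestrict g, continuousOn_iff_continuous_domRestrict.1 hg⟩ (a₀ := (⟨x₀, hx₀⟩ : s)) he
    fun x ↦ hmaps x.2
  refine ⟨fun x ↦ if hx : x ∈ s then F ⟨x, hx⟩ else e₀, ?_, by simpa [hx₀] using hF0,
    fun x hx ↦ by simpa [hx] using congrFun hF ⟨x, hx⟩⟩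
  rw [continuousOn_iff_continuous_domRestrict]
  convert F.continuous using 1
  ext x
  simp

theorem IsCoveringMapOn.exists_path_lift (hp : IsCoveringMapOn p t) {g : unitInterval → B}
    (hg : Continuous g) (hmaps : ∀ x, g x ∈ t) {e₀ : E} (he : p e₀ = g 0) :
    ∃ h : unitInterval → E, Continuous h ∧ h 0 = e₀ ∧ ∀ x, p (h x) = g x := by
  have h₀ : e₀ ∈ p ⁻¹' t := by
    rw [mem_preimage, he]
    exact hmaps 0
  obtain ⟨F, hF, hF0⟩ := hp.isCoveringMap_restrictPreimage.exists_path_lifts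
    ⟨fun x ↦ ⟨g x, hmaps x⟩, hg.subtype_mk _⟩ ⟨e₀, h₀⟩ (Subtype.ext he.symm)
  exact ⟨fun x ↦ F x, by fun_prop, congrArg Subtype.val hF0,
    fun x ↦ congrArg Subtype.val (congrFun hF x)⟩

end Lifts

/-- Removing a set without accumulation points from a connected open set leaves it connected. -/
theorem IsPreconnected.diff_of_eventually_notMem {V D : Set ℂ} (hV : IsPreconnected V)
    (hVo : IsOpen V) (hD : ∀ z ∈ V, ∀ᶠ w in 𝓝[≠] z, w ∉ D) : IsPreconnected (V \ D) := by
  have hpunct : ∀ (z : ℂ) (r : ℝ), IsPreconnected (ball z r \ {z}) := by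
    intro z r
    rcases le_or_gt r 0 with hr | hr
    · simp [ball_eq_empty.2 hr, isPreconnected_empty]
    have : ball z r \ {z} = (fun w ↦ z + Complex.exp w) '' {w | w.re < Real.log r} := by
      ext w
      constructor
      · rintro ⟨hw, hwz⟩
        have hwz' : w - z ≠ 0 := sub_ne_zero.2 hwz
        refine ⟨Complex.log (w - z), ?_, by simp [Complex.exp_log hwz']⟩
        rw [mem_ofPred_eq, Complex.log_re]
        exact Real.log_lt_log (norm_pos_iff.2 hwz') (by rwa [← dist_eq_norm])
      · rintro ⟨u, hu, rfl⟩
        refine ⟨?_, by simp⟩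
        rw [mem_ball, dist_eq_norm, add_sub_cancel_left, Complex.norm_exp]
        exact (Real.lt_log_iff_exp_lt hr).1 hu
    rw [this]
    exact ((convex_halfSpace_re_lt _).isPreconnected).image _ (by fun_prop)
  rw [isPreconnected_iff_subset_of_disjoint]
  intro A B hA hB hAB hdisj
  have hev : ∀ z ∈ V, (∀ᶠ w in 𝓝[≠] z, w ∈ A \ B) ∨ ∀ᶠ w in 𝓝[≠] z, w ∈ B \ A := by
    intro z hz
    have h1 := (hD z hz).and (eventually_nhdsWithin_of_eventually_nhds (hVo.eventually_mem hz))
    rw [eventually_nhdsWithin_iff, Metric.nhds_basis_ball.eventually_iff] at h1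
    obtain ⟨r, hr, h1⟩ := h1
    have hsub : ball z r \ {z} ⊆ V \ D := fun w hw ↦ ⟨(h1 hw.1 hw.2).2, (h1 hw.1 hw.2).1⟩
    have hnhds : ball z r \ {z} ∈ 𝓝[≠] z :=
      inter_mem (mem_nhdsWithin_of_mem_nhds (ball_mem_nhds z hr)) self_mem_nhdsWithin
    have hdis : ∀ w ∈ V \ D, w ∈ A → w ∈ B → False := fun w hw hA hB ↦
      (hdisj.le ⟨hw, hA, hB⟩)
    rcases isPreconnected_iff_subset_of_disjoint.1 (hpunct z r) A B hA hB (hsub.trans hAB)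
      (eq_empty_of_subset_empty fun w hw ↦ hdis w (hsub hw.1) hw.2.1 hw.2.2) with h | h
    · exact .inl (mem_of_superset hnhds fun w hw ↦ ⟨h hw, fun hB ↦ hdis w (hsub hw) (h hw) hB⟩)
    · exact .inr (mem_of_superset hnhds fun w hw ↦ ⟨h hw, fun hA ↦ hdis w (hsub hw) hA (h hw)⟩)
  have hopen : ∀ R : Set ℂ, IsOpen {z | ∀ᶠ w in 𝓝[≠] z, w ∈ R} := fun R ↦ by
    refine isOpen_iff_mem_nhds.2 fun z hz ↦ ?_
    have hz' : ∀ᶠ w in 𝓝[≠] z, ∀ᶠ u in 𝓝[≠] w, u ∈ R := by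
      have := eventually_eventually_nhdsWithin.2 hz
      filter_upwards [this, self_mem_nhdsWithin] with w hw hwz
      have hwz' : ({z}ᶜ : Set ℂ) ∈ 𝓝 w := isOpen_compl_singleton.mem_nhds hwz
      rw [nhdsWithin_eq_nhds.2 hwz'] at hw
      exact eventually_nhdsWithin_of_eventually_nhds hw
    rw [eventually_nhdsWithin_iff] at hz'
    filter_upwards [hz'] with w hw
    by_cases h : w = z
    · rw [h]; exact hz
    · exact hw h
  rcases isPreconnected_iff_subset_of_disjoint.1 hV _ _ (hopen (A \ B)) (hopen (B \ A))
    (fun z hz ↦ hev z hz) (eq_empty_of_subset_empty fun z hz ↦ by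
      have h1 : ∀ᶠ w in 𝓝[≠] z, w ∈ A \ B := hz.2.1
      have h2 : ∀ᶠ w in 𝓝[≠] z, w ∈ B \ A := hz.2.2
      obtain ⟨w, hw⟩ := (h1.and h2).exists
      exact hw.1.2 hw.2.1) with h | h
  · refine .inl fun z hz ↦ ((hAB hz).resolve_right fun hzB ↦ ?_)
    have h1 : ∀ᶠ w in 𝓝[≠] z, w ∈ A \ B := h hz.1
    obtain ⟨w, hw⟩ := (h1.and
      (eventually_nhdsWithin_of_eventually_nhds (hB.eventually_mem hzB))).exists
    exact hw.1.2 hw.2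
  · refine .inr fun z hz ↦ ((hAB hz).resolve_left fun hzA ↦ ?_)
    have h1 : ∀ᶠ w in 𝓝[≠] z, w ∈ B \ A := h hz.1
    obtain ⟨w, hw⟩ := (h1.and
      (eventually_nhdsWithin_of_eventually_nhds (hA.eventually_mem hzA))).exists
    exact hw.1.2 hw.2

/-- A component `E` of the preimage of a set that is biholomorphic to the punctured disk is covered
by a half-plane. -/
theorem exists_lift_exp_halfPlane {f φ φi : ℂ → ℂ} {t E : Set ℂ} (hp : IsCoveringMapOn f t)
    (hf : Continuous f) (hEo : IsOpen E) (hEc : IsConnected E) (hEt : MapsTo f E t)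
    (hE : ∀ S : Set ℂ, IsPreconnected S → S ⊆ f ⁻¹' t → (S ∩ E).Nonempty → S ⊆ E)
    (hto : IsOpen t) (hφ : ContinuousOn φ t) (hφb : BijOn φ t (ball 0 1 \ {0}))
    (hφi : ContinuousOn φi (ball 0 1 \ {0})) (hinv : InvOn φi φ t (ball 0 1 \ {0})) :
    ∃ h : ℂ → ℂ, MapsTo h {z | z.re < 0} E ∧ SurjOn h {z | z.re < 0} E ∧
      (∀ z, z.re < 0 → φ (f (h z)) = Complex.exp z) ∧
      (∀ z, z.re < 0 → ∀ A ∈ 𝓝 z, h '' A ∈ 𝓝 (h z)) ∧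
      ∃ d : ℕ, ∀ z, z.re < 0 → ∀ w, w.re < 0 →
        (h z = h w ↔ ∃ k : ℤ, z = w + k * d * (2 * Real.pi * Complex.I)) := by
  set H : Set ℂ := {z | z.re < 0} with hH
  have hHo : IsOpen H := isOpen_lt Complex.continuous_re continuous_const
  have hHconv : Convex ℝ H := convex_halfSpace_re_lt 0
  have hHmem : ∀ z, z ∈ H ↔ z.re < 0 := fun z ↦ Iff.rfl
  have hHsc : IsSimplyConnected H := by
    have : ContractibleSpace H := hHconv.contractibleSpace ⟨-1, by simp [hHmem]⟩
    exact (inferInstance : SimplyConnectedSpace H)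
  have hexp : MapsTo Complex.exp H (ball 0 1 \ {0}) := fun z hz ↦ by
    refine ⟨?_, Complex.exp_ne_zero z⟩
    rw [mem_ball_zero_iff, Complex.norm_exp]
    exact Real.exp_lt_one_iff.2 hz
  have hφim : MapsTo φi (ball 0 1 \ {0}) t := fun z hz ↦ by
    obtain ⟨w, hw, rfl⟩ := hφb.surjOn hz
    rwa [hinv.1 hw]
  obtain ⟨e₀, he₀⟩ := hEc.nonempty
  have hlog : ∀ e ∈ E, Complex.log (φ (f e)) ∈ H ∧
      Complex.exp (Complex.log (φ (f e))) = φ (f e) := fun e he ↦ by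
    obtain ⟨h1, h2⟩ := hφb.mapsTo (hEt he)
    refine ⟨?_, Complex.exp_log h2⟩
    rw [hHmem, Complex.log_re]
    exact Real.log_neg (norm_pos_iff.2 h2) (mem_ball_zero_iff.1 h1)
  obtain ⟨hz₀, hez₀⟩ := hlog e₀ he₀
  set z₀ := Complex.log (φ (f e₀))
  have hκ : ContinuousOn (fun z ↦ φi (Complex.exp z)) H :=
    hφi.comp Complex.continuous_exp.continuousOn hexp
  obtain ⟨h, hc, h0, hh⟩ := hp.exists_lift hHo hHsc hκ (hφim.comp hexp) hz₀ (e₀ := e₀)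
    (by rw [hez₀, hinv.1 (hEt he₀)])
  have hht : ∀ z ∈ H, f (h z) ∈ t := fun z hz ↦ by
    rw [hh z hz]
    exact hφim (hexp hz)
  have hmaps : MapsTo h H E := by
    rw [mapsTo_iff_image_subset]
    refine hE _ (hHconv.isPreconnected.image h hc) ?_ ⟨e₀, ⟨z₀, hz₀, h0⟩, he₀⟩
    rintro _ ⟨z, hz, rfl⟩
    exact hht z hz
  have hg : ∀ z ∈ H, φ (f (h z)) = Complex.exp z := fun z hz ↦ by
    rw [hh z hz, hinv.2 (hexp hz)]
  refine ⟨h, hmaps, fun e he ↦ ?_, hg, fun z hz A hA ↦ ?_, ?_⟩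
  · obtain ⟨γ, hγ⟩ := (hEo.isConnected_iff_isPathConnected.1 hEc).joinedIn e₀ he₀ e he
    have hcont : Continuous fun s ↦ φ (f (γ s)) :=
      hφ.comp_continuous (by fun_prop) fun s ↦ hEt (hγ s)
    obtain ⟨δ, hδc, hδ0, hδ⟩ := Complex.isCoveringMapOn_exp.exists_path_lift hcont
      (fun s ↦ (hφb.mapsTo (hEt (hγ s))).2) (e₀ := z₀) (by simp [hez₀])
    have hδH : ∀ s, δ s ∈ H := fun s ↦ by
      have := (hφb.mapsTo (hEt (hγ s))).1
      rw [← hδ s, mem_ball_zero_iff, Complex.norm_exp, Real.exp_lt_one_iff] at this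
      exact this
    have key := hp.eqOn_of_comp_eqOn isPreconnected_univ (g₁ := fun s ↦ h (δ s)) (g₂ := γ)
      (hc.comp_continuous hδc hδH).continuousOn γ.continuous.continuousOn
      (fun s _ ↦ hht _ (hδH s)) (fun s _ ↦ by
        rw [hh _ (hδH s), hδ s, hinv.1 (hEt (hγ s))]) (mem_univ 0) (by simp [hδ0, h0])
    refine ⟨δ 1, hδH 1, ?_⟩
    simpa using key (mem_univ 1)
  · obtain ⟨P, hPs, hP⟩ := hp.isLocalHomeomorphOn (h z) (hht z hz)
    have hhz : ContinuousAt h z := hc.continuousAt (hHo.mem_nhds hz)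
    set A' := A ∩ H ∩ h ⁻¹' P.source
    have hA' : A' ∈ 𝓝 z := inter_mem (inter_mem hA (hHo.mem_nhds hz))
      (hhz.preimage_mem_nhds (P.open_source.mem_nhds hPs))
    have hgc : ContinuousAt (fun u ↦ φ (f u)) (h z) :=
      (hφ.continuousAt (hto.mem_nhds (hht z hz))).comp hf.continuousAt
    have h1 : Complex.exp '' A' ∈ 𝓝 (φ (f (h z))) := by
      rw [hg z hz]
      exact Complex.isOpenMap_exp.image_mem_nhds hA'
    filter_upwards [hgc.preimage_mem_nhds h1, hEo.mem_nhds (hmaps hz),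
      P.open_source.mem_nhds hPs] with u ⟨w, hw, hwu⟩ huE huP
    refine ⟨w, hw.1.1, P.injOn hw.2 huP ?_⟩
    rw [← hP]
    refine hφb.injOn (hht w hw.1.2) (hEt huE) ?_
    rw [hg w hw.1.2, hwu]
  · have hshift : ∀ z ∈ H, ∀ n : ℤ, z + n * (2 * Real.pi * Complex.I) ∈ H := fun z hz n ↦ by
      simpa [hHmem] using hz
    let Γ : AddSubgroup ℤ :=
      { carrier := {n | ∀ z ∈ H, h (z + n * (2 * Real.pi * Complex.I)) = h z}
        add_mem' := fun {m n} hm hn z hz ↦ by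
          rw [← hm z hz, ← hn _ (hshift z hz m)]
          push_cast
          ring_nf
        zero_mem' := fun z _ ↦ by simp
        neg_mem' := fun {n} hn z hz ↦ by
          rw [← hn _ (hshift z hz (-n))]
          push_cast
          ring_nf }
    have hΓ : ∀ n, n ∈ Γ ↔ ∀ z ∈ H, h (z + n * (2 * Real.pi * Complex.I)) = h z := fun n ↦ Iff.rfl
    obtain ⟨d, hd⟩ := Int.subgroup_cyclic Γ
    have hdΓ : ∀ n, n ∈ Γ ↔ ∃ k : ℤ, n = k * d.natAbs := fun n ↦ by
      rw [hd, AddSubgroup.mem_closure_singleton]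
      rcases Int.natAbs_eq d with h | h
      · rw [← h]
        simp [eq_comm]
      · constructor
        · rintro ⟨k, rfl⟩
          exact ⟨-k, by rw [smul_eq_mul]; grind⟩
        · rintro ⟨k, rfl⟩
          exact ⟨-k, by rw [smul_eq_mul]; grind⟩
    refine ⟨d.natAbs, fun z hz w hw ↦ ⟨fun hzw ↦ ?_, ?_⟩⟩
    · obtain ⟨n, rfl⟩ := Complex.exp_eq_exp_iff_exists_int.1
        (show Complex.exp z = Complex.exp w by rw [← hg z hz, ← hg w hw, hzw])
      have hn : n ∈ Γ := fun u hu ↦ by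
        refine hp.eqOn_of_comp_eqOn hHconv.isPreconnected
          (g₁ := fun u ↦ h (u + n * (2 * Real.pi * Complex.I))) (g₂ := h)
          (hc.comp (by fun_prop) fun u hu ↦ hshift u hu n) hc (fun u hu ↦ hht _ (hshift u hu n))
          (fun u hu ↦ ?_) hw hzw hu
        rw [hh _ (hshift u hu n), hh u hu, Complex.exp_periodic.int_mul n u]
      obtain ⟨k, rfl⟩ := (hdΓ n).1 hn
      exact ⟨k, by rw [Int.cast_mul, Int.cast_natCast]⟩
    · rintro ⟨k, rfl⟩
      have := (hΓ _).1 ((hdΓ (k * d.natAbs)).2 ⟨k, rfl⟩) w hw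
      rwa [Int.cast_mul, Int.cast_natCast] at this

/-- Descending a function `q` along an open surjection `h`. -/
theorem exists_differentiableOn_of_comp_eq {h q P P' g : ℂ → ℂ} {H E : Set ℂ} (hHo : IsOpen H)
    (hmaps : MapsTo h H E) (hsurj : SurjOn h H E) (hopen : ∀ z ∈ H, ∀ A ∈ 𝓝 z, h '' A ∈ 𝓝 (h z))
    (hq : ContinuousOn q H) (hhq : ∀ z ∈ H, ∀ w ∈ H, h z = h w ↔ q z = q w)
    (hP : ∀ z ∈ H, HasStrictDerivAt P (P' (q z)) (q z)) (hP' : ∀ z ∈ H, P' (q z) ≠ 0)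
    (hPq : ∀ z ∈ H, P (q z) = g (h z)) (hg : ∀ e ∈ E, DifferentiableAt ℂ g e) :
    ∃ ψ : ℂ → ℂ, DifferentiableOn ℂ ψ E ∧ BijOn ψ E (q '' H) ∧ ∀ e ∈ E, P (ψ e) = g e := by
  choose! s hsH hs using fun e (he : e ∈ E) ↦ hsurj he
  have hψ : ∀ z ∈ H, q (s (h z)) = q z := fun z hz ↦
    (hhq _ (hsH _ (hmaps hz)) z hz).1 (hs _ (hmaps hz))
  refine ⟨fun e ↦ q (s e), fun e he ↦ ?_, ⟨fun e he ↦ mem_image_of_mem q (hsH _ he), ?_, ?_⟩,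
    fun e he ↦ by simp only [hPq _ (hsH _ he), hs _ he]⟩
  · have hmemE : h '' H ∈ 𝓝 e := by
      rw [← hs _ he]
      exact hopen _ (hsH _ he) H (hHo.mem_nhds (hsH _ he))
    have hcont : ContinuousAt (fun e ↦ q (s e)) e := by
      intro O hO
      have h1 := hopen _ (hsH _ he) _ (inter_mem (hHo.mem_nhds (hsH _ he))
        ((hq.continuousAt (hHo.mem_nhds (hsH _ he))).preimage_mem_nhds hO))
      rw [hs _ he] at h1
      rw [Filter.mem_map]
      filter_upwards [h1]
      rintro _ ⟨w, hw, rfl⟩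
      simpa only [mem_preimage, hψ w hw.1] using hw.2
    refine (hcont.differentiableAt_of_comp_eq (hP _ (hsH _ he)) (hP' _ (hsH _ he)) (hg e he)
      ?_).differentiableWithinAt
    filter_upwards [hmemE]
    rintro _ ⟨z, hz, rfl⟩
    rw [hψ z hz, hPq z hz]
  · intro e he e' he' hee
    rw [← hs _ he, ← hs _ he']
    exact (hhq _ (hsH _ he) _ (hsH _ he')).2 hee
  · rintro _ ⟨z, hz, rfl⟩
    exact ⟨h z, hmaps hz, hψ z hz⟩

theorem AnalyticOnNhd.image_mem_nhds_of_injOn {ψ : ℂ → ℂ} {V : Set ℂ} (hVo : IsOpen V)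
    (hψ : AnalyticOnNhd ℂ ψ V) (hi : InjOn ψ V) {x : ℂ} (hx : x ∈ V) {A : Set ℂ} (hA : A ∈ 𝓝 x) :
    ψ '' A ∈ 𝓝 (ψ x) := by
  rcases (hψ x hx).eventually_constant_or_nhds_le_map_nhds with h | h
  · have h1 : ∀ᶠ z in 𝓝[≠] x, ψ z = ψ x ∧ z ∈ V ∧ z ≠ x :=
      (eventually_nhdsWithin_of_eventually_nhds (h.and (hVo.eventually_mem hx))).and
        self_mem_nhdsWithin |>.mono fun z hz ↦ ⟨hz.1.1, hz.1.2, hz.2⟩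
    obtain ⟨z, hz1, hz2, hz3⟩ := h1.exists
    exact absurd (hi hz2 hx hz1) hz3
  · exact h (image_mem_map hA)

theorem exists_continuousOn_invOn {ψ : ℂ → ℂ} {V W : Set ℂ} (hVo : IsOpen V)
    (hψ : DifferentiableOn ℂ ψ V) (hb : BijOn ψ V W) :
    ∃ θ : ℂ → ℂ, ContinuousOn θ W ∧ MapsTo θ W V ∧ InvOn θ ψ V W := by
  have hinv := hb.invOn_invFunOn
  have hmaps := hb.surjOn.mapsTo_invFunOn
  refine ⟨Function.invFunOn ψ V, fun w hw ↦ ContinuousAt.continuousWithinAt fun A hA ↦ ?_,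
    hmaps, hinv⟩
  have h1 := (hψ.analyticOnNhd hVo).image_mem_nhds_of_injOn hVo hb.injOn (hmaps hw)
    (inter_mem hA (hVo.mem_nhds (hmaps hw)))
  rw [hinv.2 hw] at h1
  rw [Filter.mem_map]
  filter_upwards [h1]
  rintro _ ⟨z, hz, rfl⟩
  rw [mem_preimage, hinv.1 hz.2]
  exact hz.1

theorem IsSimplyConnected.of_bijOn {ψ : ℂ → ℂ} {V W : Set ℂ} (hVo : IsOpen V)
    (hψ : DifferentiableOn ℂ ψ V) (hb : BijOn ψ V W) (hW : IsSimplyConnected W) :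
    IsSimplyConnected V := by
  obtain ⟨θ, hθ, hθm, hinv⟩ := exists_continuousOn_invOn hVo hψ hb
  let e : V ≃ₜ W :=
    { toFun x := ⟨ψ x, hb.mapsTo x.2⟩
      invFun y := ⟨θ y, hθm y.2⟩
      left_inv x := Subtype.ext (hinv.1 x.2)
      right_inv y := Subtype.ext (hinv.2 y.2)
      continuous_toFun := (continuousOn_iff_continuous_domRestrict.1 hψ.continuousOn).subtype_mk _
      continuous_invFun := (continuousOn_iff_continuous_domRestrict.1 hθ).subtype_mk _ }
  exact e.toHomotopyEquiv.simplyConnectedSpace_iff.2 hW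

theorem IsSimplyConnected.of_convex {W : Set ℂ} (hW : Convex ℝ W) (hne : W.Nonempty) :
    IsSimplyConnected W := by
  have : ContractibleSpace W := hW.contractibleSpace hne
  exact (inferInstance : SimplyConnectedSpace W)

/-- A holomorphic function has no logarithm in a punctured neighborhood of a zero. -/
theorem not_eventually_exp_eq_of_eq_zero {g ψ : ℂ → ℂ} {p : ℂ} (hg : AnalyticAt ℂ g p)
    (h0 : g p = 0) :
    ¬ ∀ᶠ z in 𝓝[≠] p, DifferentiableAt ℂ ψ z ∧ Complex.exp (ψ z) = g z := by
  intro h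
  have hne : analyticOrderAt g p ≠ ⊤ := by
    rw [Ne, analyticOrderAt_eq_top]
    intro hz
    obtain ⟨z, hz1, hz2⟩ := ((eventually_nhdsWithin_of_eventually_nhds hz).and h).exists
    exact Complex.exp_ne_zero _ (hz2.2.trans hz1)
  obtain ⟨n, hn⟩ := ENat.ne_top_iff_exists.1 hne
  have hn0 : n ≠ 0 := by
    rintro rfl
    exact (hg.analyticOrderAt_eq_zero.1 hn.symm) h0
  set F : ℂ → ℂ := Function.update (fun z ↦ Complex.exp (ψ z / (n + 1))) p 0 with hF
  have hpow : ∀ᶠ z in 𝓝 p, F z ^ (n + 1) = g z := by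
    rw [← nhdsNE_sup_pure, eventually_sup]
    refine ⟨?_, by simp [hF, h0]⟩
    filter_upwards [h, self_mem_nhdsWithin] with z hz hzp
    rw [hF, Function.update_of_ne hzp, ← Complex.exp_nat_mul, ← hz.2]
    congr 1
    have : (n : ℂ) + 1 ≠ 0 := by exact_mod_cast n.succ_ne_zero
    push_cast
    field_simp
  have hFc : ContinuousAt F p := by
    have hFp : F p = 0 := by simp [hF]
    rw [ContinuousAt, hFp, tendsto_zero_iff_norm_tendsto_zero]
    have h1 : Tendsto (fun z ↦ ‖g z‖ ^ ((n + 1 : ℕ) : ℝ)⁻¹) (𝓝 p) (𝓝 0) := by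
      have := hg.continuousAt.norm.rpow_const (p := ((n + 1 : ℕ) : ℝ)⁻¹) (.inr (by positivity))
      rw [ContinuousAt, h0, norm_zero, Real.zero_rpow (by positivity)] at this
      exact this
    refine h1.congr' ?_
    filter_upwards [hpow] with z hz
    rw [← hz, norm_pow, Real.pow_rpow_inv_natCast (norm_nonneg _) n.succ_ne_zero]
  have hFd : ∀ᶠ z in 𝓝[≠] p, DifferentiableAt ℂ F z := by
    filter_upwards [h, self_mem_nhdsWithin] with z hz hzp
    have : DifferentiableAt ℂ (fun z ↦ Complex.exp (ψ z / (n + 1))) z :=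
      (hz.1.div_const _).cexp
    refine this.congr_of_eventuallyEq ?_
    filter_upwards [isOpen_ne.mem_nhds hzp] with y hy
    rw [hF, Function.update_of_ne hy]
  have hFa := Complex.analyticAt_of_differentiable_on_punctured_nhds_of_continuousAt hFd hFc
  have h2 := analyticOrderAt_pow hFa (n + 1)
  have h3 : analyticOrderAt (F ^ (n + 1)) p = analyticOrderAt g p := analyticOrderAt_congr hpow
  rw [h3, ← hn] at h2
  have hFtop : analyticOrderAt F p ≠ ⊤ := by
    intro htop
    rw [htop] at h2
    simp at h2
  obtain ⟨m, hm⟩ := ENat.ne_top_iff_exists.1 hFtop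
  rw [← hm, nsmul_eq_mul] at h2
  have h4 : n = (n + 1) * m := by exact_mod_cast h2
  rcases m with _ | m
  · simp at h4
    exact hn0 h4
  · nlinarith

/-- A `d`-th root with values in the punctured disk extends to the isolated zeros. -/
theorem exists_extension_pow_eq {g ψ : ℂ → ℂ} {V E : Set ℂ} {d : ℕ} (hd : d ≠ 0) (hVo : IsOpen V)
    (hEo : IsOpen E) (hisol : ∀ p ∈ V \ E, ∀ᶠ z in 𝓝[≠] p, z ∈ E)
    (hg : ContinuousOn g V) (hg0 : ∀ p ∈ V \ E, g p = 0) (hψ : DifferentiableOn ℂ ψ E)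
    (hψb : BijOn ψ E (ball 0 1 \ {0})) (hψg : ∀ z ∈ E, g z = ψ z ^ d) :
    ∃ χ : ℂ → ℂ, DifferentiableOn ℂ χ V ∧ InjOn χ V ∧ MapsTo χ V (ball 0 1) ∧ EqOn χ ψ E ∧
      (∀ p ∈ V \ E, χ p = 0) ∧ ∀ z ∈ V, g z = χ z ^ d := by
  classical
  set χ : ℂ → ℂ := E.indicator ψ with hχ
  have hχE : EqOn χ ψ E := fun z hz ↦ indicator_of_mem hz ψ
  have hχ0 : ∀ p ∉ E, χ p = 0 := fun p hp ↦ indicator_of_notMem hp ψ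
  have hpow : ∀ z ∈ V, g z = χ z ^ d := fun z hz ↦ by
    by_cases hzE : z ∈ E
    · rw [hχE hzE, hψg z hzE]
    · rw [hχ0 z hzE, hg0 z ⟨hz, hzE⟩, zero_pow hd]
  have hdE : ∀ z ∈ E, DifferentiableAt ℂ χ z := fun z hz ↦
    (hψ.differentiableAt (hEo.mem_nhds hz)).congr_of_eventuallyEq
      (hχE.eventuallyEq_of_mem (hEo.mem_nhds hz))
  have hχd : DifferentiableOn ℂ χ V := by
    intro p hp
    refine DifferentiableAt.differentiableWithinAt ?_
    by_cases hpE : p ∈ E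
    · exact hdE p hpE
    refine (Complex.analyticAt_of_differentiable_on_punctured_nhds_of_continuousAt
      ((hisol p ⟨hp, hpE⟩).mono hdE) ?_).differentiableAt
    rw [ContinuousAt, hχ0 p hpE, tendsto_zero_iff_norm_tendsto_zero]
    have h1 : Tendsto (fun z ↦ ‖g z‖ ^ (d : ℝ)⁻¹) (𝓝 p) (𝓝 0) := by
      have := (hg.continuousAt (hVo.mem_nhds hp)).norm.rpow_const (p := (d : ℝ)⁻¹)
        (.inr (by positivity))
      rw [ContinuousAt, hg0 p ⟨hp, hpE⟩, norm_zero, Real.zero_rpow (by positivity)] at this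
      exact this
    refine h1.congr' ?_
    filter_upwards [hVo.mem_nhds hp] with z hz
    rw [hpow z hz, norm_pow, Real.pow_rpow_inv_natCast (norm_nonneg _) hd]
  have hopen : ∀ p ∈ V \ E, ∀ A ∈ 𝓝 p, χ '' A ∈ 𝓝 (0 : ℂ) := by
    intro p hp A hA
    rcases (hχd.analyticOnNhd hVo p hp.1).eventually_constant_or_nhds_le_map_nhds with h | h
    · obtain ⟨z, hz1, hz2⟩ :=
        ((eventually_nhdsWithin_of_eventually_nhds h).and (hisol p hp)).exists
      rw [hχ0 p hp.2, hχE hz2] at hz1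
      exact absurd hz1 (hψb.mapsTo hz2).2
    · rw [hχ0 p hp.2] at h
      exact h (image_mem_map hA)
  refine ⟨χ, hχd, ?_, fun z hz ↦ ?_, hχE, fun p hp ↦ hχ0 p hp.2, hpow⟩
  · have hEne : ∀ z ∈ E, χ z ≠ 0 := fun z hz ↦ by
      rw [hχE hz]
      exact (hψb.mapsTo hz).2
    intro x hx y hy hxy
    by_cases hxE : x ∈ E
    · by_cases hyE : y ∈ E
      · rw [hχE hxE, hχE hyE] at hxy
        exact hψb.injOn hxE hyE hxy
      · exact absurd (hxy.trans (hχ0 y hyE)) (hEne x hxE)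
    · by_cases hyE : y ∈ E
      · exact absurd (hxy.symm.trans (hχ0 x hxE)) (hEne y hyE)
      by_contra hne
      obtain ⟨A, B, hA, hB, hAB⟩ := t2_separation_nhds hne
      have h1 : ∀ᶠ w in 𝓝[≠] (0 : ℂ), w ∈ χ '' A ∧ w ∈ χ '' B ∧ w ≠ 0 := by
        filter_upwards [nhdsWithin_le_nhds (hopen x ⟨hx, hxE⟩ A hA),
          nhdsWithin_le_nhds (hopen y ⟨hy, hyE⟩ B hB), self_mem_nhdsWithin] with w h1 h2 h3
        exact ⟨h1, h2, h3⟩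
      obtain ⟨w, ⟨u, hu, rfl⟩, ⟨u', hu', huu⟩, hw0⟩ := h1.exists
      have huE : u ∈ E := by
        by_contra h
        exact hw0 (hχ0 u h)
      have huE' : u' ∈ E := by
        by_contra h
        exact hw0 (huu ▸ hχ0 u' h)
      rw [hχE huE, hχE huE'] at huu
      obtain rfl := hψb.injOn huE' huE huu
      exact disjoint_left.1 hAB hu hu'
  · by_cases hzE : z ∈ E
    · rw [hχE hzE]
      exact (hψb.mapsTo hzE).1
    · rw [hχ0 z hzE]
      simp

/-- A component of `f ⁻¹' U` on which `φ ∘ f` is the `d`-th power of a biholomorphism onto a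
punctured disk has its puncture at infinity, so that `f` is bounded. -/
theorem false_of_bijOn_punctured_ball {f φi ψ : ℂ → ℂ} {U V : Set ℂ} {d : ℕ} (hd : d ≠ 0)
    (hf : Differentiable ℂ f) (hfc : ¬ ∃ c, ∀ z, f z = c) (hUo : IsOpen U) (hVo : IsOpen V)
    (hV : ∀ S : Set ℂ, IsPreconnected S → S ⊆ f ⁻¹' U → (S ∩ V).Nonempty → S ⊆ V)
    (hφi : ContinuousOn φi (ball 0 1)) (hφiU : φi 0 ∈ U) (hψ : DifferentiableOn ℂ ψ V)
    (hψb : BijOn ψ V (ball 0 1 \ {0})) (hψf : ∀ z ∈ V, f z = φi (ψ z ^ d))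
    (hVa : ∀ z ∈ V, f z ≠ φi 0) : False := by
  obtain ⟨θ, hθ, hθm, hinv⟩ := exists_continuousOn_invOn hVo hψ hψb
  have hpunct : ∀ᶠ w in 𝓝[≠] (0 : ℂ), w ∈ ball (0 : ℂ) 1 \ {0} :=
    inter_mem (mem_nhdsWithin_of_mem_nhds (ball_mem_nhds _ one_pos)) self_mem_nhdsWithin
  have hlim : Tendsto (fun w ↦ f (θ w)) (𝓝[≠] 0) (𝓝 (φi 0)) := by
    have h1 : Tendsto (fun w : ℂ ↦ φi (w ^ d)) (𝓝[≠] 0) (𝓝 (φi 0)) := by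
      have h2 : ContinuousAt φi ((0 : ℂ) ^ d) := by
        rw [zero_pow hd]
        exact hφi.continuousAt (ball_mem_nhds _ one_pos)
      have h3 : ContinuousAt (fun w : ℂ ↦ φi (w ^ d)) 0 :=
        ContinuousAt.comp (f := fun w : ℂ ↦ w ^ d) h2 (by fun_prop)
      rw [ContinuousAt, zero_pow hd] at h3
      exact h3.mono_left nhdsWithin_le_nhds
    refine h1.congr' ?_
    filter_upwards [hpunct] with w hw
    rw [hψf _ (hθm hw), hinv.2 hw]
  have hinf : ∀ R : ℝ, ∀ᶠ w in 𝓝[≠] (0 : ℂ), R < ‖θ w‖ := by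
    intro R
    by_contra hR
    have hfreq : ∃ᶠ w in 𝓝[≠] (0 : ℂ), θ w ∈ closedBall (0 : ℂ) R := by
      refine (not_eventually.1 hR).mono fun w hw ↦ ?_
      rw [mem_closedBall_zero_iff]
      exact not_lt.1 hw
    obtain ⟨p, -, hp⟩ := (isCompact_closedBall (0 : ℂ) R).exists_mapClusterPt_of_frequently hfreq
    have hfp : f p = φi 0 := by
      have h1 : MapClusterPt (f p) (𝓝[≠] (0 : ℂ)) (f ∘ θ) :=
        hp.continuousAt_comp hf.continuous.continuousAt
      exact eq_of_nhds_neBot (h1.neBot.mono (inf_le_inf_left _ hlim))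
    have hpU : f ⁻¹' U ∈ 𝓝 p := hf.continuous.continuousAt.preimage_mem_nhds
      (hUo.mem_nhds (hfp ▸ hφiU))
    obtain ⟨r, hr, hrU⟩ := Metric.mem_nhds_iff.1 hpU
    obtain ⟨w, hw1, hw2⟩ := ((mapClusterPt_iff_frequently.1 hp _
      (ball_mem_nhds p hr)).and_eventually hpunct).exists
    exact hVa p (hV _ (convex_ball p r).isPreconnected hrU ⟨_, hw1, hθm hw2⟩ (mem_ball_self hr)) hfp
  have hann : ∀ δ : ℝ, 0 < δ → ∀ K ⊆ {w : ℂ | δ ≤ ‖w‖ ∧ ‖w‖ ≤ 1 / 2}, IsClosed K →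
      IsCompact (θ '' K) := by
    intro δ hδ K hK hKc
    refine ((isCompact_closedBall (0 : ℂ) (1 / 2)).of_isClosed_subset hKc
      fun w hw ↦ ?_).image_of_continuousOn (hθ.mono fun w hw ↦ ?_)
    · simpa using (hK hw).2
    · have := hK hw
      exact ⟨by simpa using this.2.trans_lt (by norm_num), norm_pos_iff.1 (hδ.trans_le this.1)⟩
  obtain ⟨R, hR⟩ := (hann (1 / 2) (by norm_num) (sphere 0 (1 / 2))
    (fun w hw ↦ by simp [mem_sphere_zero_iff_norm.1 hw])
    isClosed_sphere).isBounded.subset_closedBall 0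
  set W : Set ℂ := {z ∈ V | ‖ψ z‖ < 1 / 2} with hW
  have hWo : IsOpen W := hψ.continuousOn.norm.isOpen_inter_preimage hVo isOpen_Iio
  set S : Set ℂ := {z | max R 1 < ‖z‖} with hS
  have hSc : IsPreconnected S := by
    have : S = Complex.exp '' {w | Real.log (max R 1) < w.re} := by
      have hpos : 0 < max R 1 := lt_max_of_lt_right one_pos
      ext z
      constructor
      · intro hz
        have hz' : max R 1 < ‖z‖ := hz
        have hz0 : z ≠ 0 := norm_pos_iff.1 (hpos.trans hz')
        refine ⟨Complex.log z, ?_, Complex.exp_log hz0⟩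
        rw [mem_ofPred_eq, Complex.log_re]
        exact Real.log_lt_log hpos hz'
      · rintro ⟨w, hw, rfl⟩
        rw [hS, mem_ofPred_eq, Complex.norm_exp]
        exact (Real.log_lt_iff_lt_exp hpos).1 hw
    rw [this]
    exact (convex_halfSpace_re_gt _).isPreconnected.image _ Complex.continuous_exp.continuousOn
  have hSW : S ⊆ W := by
    refine hSc.subset_of_closure_inter_subset hWo ?_ ?_
    · have h1 : ∀ᶠ w in 𝓝[≠] (0 : ℂ), w ∈ ball (0 : ℂ) (1 / 2) :=
        mem_nhdsWithin_of_mem_nhds (ball_mem_nhds _ (by norm_num))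
      obtain ⟨w, ⟨hw1, hw2⟩, hw3⟩ := ((hpunct.and h1).and (hinf (max R 1))).exists
      refine ⟨θ w, hw3, hθm hw1, ?_⟩
      rw [hinv.2 hw1]
      simpa using hw2
    · rintro z ⟨hzW, hzS⟩
      obtain ⟨δ, hδ, hδs⟩ := Metric.nhdsWithin_basis_ball.eventually_iff.1 (hinf (‖z‖ + 1))
      have hK := hann δ hδ {w | δ ≤ ‖w‖ ∧ ‖w‖ ≤ 1 / 2} subset_rfl
        ((isClosed_le continuous_const continuous_norm).inter
          (isClosed_le continuous_norm continuous_const))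
      have hz : z ∈ θ '' {w | δ ≤ ‖w‖ ∧ ‖w‖ ≤ 1 / 2} := by
        rw [← hK.isClosed.closure_eq]
        refine closure_mono ?_ (isOpen_ball.closure_inter ⟨hzW, mem_ball_self one_pos⟩)
        rintro u ⟨⟨huV, hu⟩, huz⟩
        refine ⟨ψ u, ⟨not_lt.1 fun hlt ↦ ?_, hu.le⟩, hinv.1 huV⟩
        have h1 := hδs (x := ψ u) ⟨mem_ball_zero_iff.2 hlt, (hψb.mapsTo huV).2⟩
        rw [hinv.1 huV] at h1
        have h2 := norm_sub_norm_le u z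
        rw [mem_ball_iff_norm] at huz
        linarith
      obtain ⟨w, ⟨hw1, hw2⟩, rfl⟩ := hz
      have hwp : w ∈ ball (0 : ℂ) 1 \ {0} :=
        ⟨by simpa using hw2.trans_lt (by norm_num), norm_pos_iff.1 (hδ.trans_le hw1)⟩
      refine ⟨hθm hwp, ?_⟩
      rw [hinv.2 hwp]
      refine lt_of_le_of_ne hw2 fun hw ↦ ?_
      have := hR (mem_image_of_mem θ (mem_sphere_zero_iff_norm.2 hw))
      rw [mem_closedBall_zero_iff] at this
      have h2 : max R 1 < ‖θ w‖ := hzS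
      exact absurd (this.trans (le_max_left _ _)) (not_le.2 h2)
  have hbW : Bornology.IsBounded (f '' W) := by
    refine ((isCompact_closedBall (0 : ℂ) (1 / 2)).image_of_continuousOn
      (hφi.mono (closedBall_subset_ball (by norm_num)))).isBounded.subset ?_
    rintro _ ⟨z, hz, rfl⟩
    refine ⟨ψ z ^ d, ?_, (hψf z hz.1).symm⟩
    rw [mem_closedBall_zero_iff, norm_pow]
    exact (pow_le_of_le_one (norm_nonneg _) (by linarith [hz.2]) hd).trans hz.2.le
  have hb : Bornology.IsBounded (range f) := by
    have h1 : Bornology.IsBounded (f '' closedBall 0 (max R 1)) :=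
      ((isCompact_closedBall _ _).image hf.continuous).isBounded
    refine (hbW.union h1).subset ?_
    rintro _ ⟨z, rfl⟩
    rcases lt_or_ge (max R 1) ‖z‖ with h | h
    · exact .inl ⟨z, hSW h, rfl⟩
    · exact .inr ⟨z, by simpa using h, rfl⟩
  exact hfc ⟨f 0, fun z ↦ hf.apply_eq_apply_of_bounded hb z 0⟩

theorem AnalyticOnNhd.eventually_ne_of_not_const {f : ℂ → ℂ} (hf : AnalyticOnNhd ℂ f univ)
    (hfc : ¬ ∃ c, ∀ z, f z = c) (a z : ℂ) : ∀ᶠ w in 𝓝[≠] z, f w ≠ a := by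
  refine ((hf z (mem_univ z)).eventually_eq_or_eventually_ne analyticAt_const).resolve_left
    fun h ↦ hfc ⟨a, fun w ↦ ?_⟩
  exact congrFun (hf.eq_of_eventuallyEq (fun _ _ ↦ analyticAt_const) h) w

theorem image_exp_div_halfPlane {d : ℕ} (hd : d ≠ 0) :
    (fun z : ℂ ↦ Complex.exp (z / d)) '' {z | z.re < 0} = ball 0 1 \ {0} := by
  have hd' : (d : ℂ) ≠ 0 := Nat.cast_ne_zero.2 hd
  have hdr : (0 : ℝ) < d := by positivity
  ext w
  constructor
  · rintro ⟨z, hz, rfl⟩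
    have hz' : z.re < 0 := hz
    refine ⟨?_, Complex.exp_ne_zero _⟩
    rw [mem_ball_zero_iff, Complex.norm_exp, Complex.div_natCast_re, Real.exp_lt_one_iff]
    exact div_neg_of_neg_of_pos hz' hdr
  · rintro ⟨hw1, hw0 : w ≠ 0⟩
    refine ⟨d * Complex.log w, ?_, ?_⟩
    · have : Real.log ‖w‖ < 0 :=
        Real.log_neg (norm_pos_iff.2 hw0) (mem_ball_zero_iff.1 hw1)
      rw [mem_ofPred_eq, ← nsmul_eq_mul, Complex.re_nsmul, nsmul_eq_mul, Complex.log_re]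
      exact mul_neg_of_pos_of_neg hdr this
    · simp only [mul_div_cancel_left₀ _ hd', Complex.exp_log hw0]

/-- The component is a logarithmic tract, or a `d`-fold branched cover of the disk. -/
theorem exists_exp_or_pow {f φ : ℂ → ℂ} {a : ℂ} {U V : Set ℂ} (hf : Differentiable ℂ f)
    (hfc : ¬ ∃ c, ∀ z, f z = c) (hUo : IsOpen U) (haU : a ∈ U)
    (hcov : IsCoveringMapOn f (U \ {a})) (hVo : IsOpen V) (hVc : IsConnected V)
    (hVU : V ⊆ f ⁻¹' U)
    (hV : ∀ S : Set ℂ, IsPreconnected S → S ⊆ f ⁻¹' U → (S ∩ V).Nonempty → S ⊆ V)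
    (hφ : DifferentiableOn ℂ φ U) (hφb : BijOn φ U (ball 0 1)) (hφa : φ a = 0) :
    (∃ d : ℕ, 1 ≤ d ∧ ∃ ψ : ℂ → ℂ, DifferentiableOn ℂ ψ V ∧ BijOn ψ V (ball 0 1) ∧
      ∀ w ∈ V, φ (f w) = ψ w ^ d) ∨
    ∃ ψ : ℂ → ℂ, DifferentiableOn ℂ ψ V ∧ BijOn ψ V {z | z.re < 0} ∧
      ∀ w ∈ V, φ (f w) = Complex.exp (ψ w) := by
  obtain ⟨φi, hφi, -, hinv⟩ := exists_continuousOn_invOn hUo hφ hφb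
  have hφi0 : φi 0 = a := by rw [← hφa, hinv.1 haU]
  have hφ0 : ∀ w ∈ U, φ w = 0 ↔ w = a := fun w hw ↦
    ⟨fun h ↦ hφb.injOn hw haU (h.trans hφa.symm), fun h ↦ h ▸ hφa⟩
  have hne : ∀ z, ∀ᶠ w in 𝓝[≠] z, f w ≠ a :=
    (hf.differentiableOn.analyticOnNhd isOpen_univ).eventually_ne_of_not_const hfc a
  set E : Set ℂ := V \ f ⁻¹' {a} with hE
  have hEo : IsOpen E := hVo.sdiff (isClosed_singleton.preimage hf.continuous)
  have hisol : ∀ p ∈ V, ∀ᶠ z in 𝓝[≠] p, z ∈ E := fun p hp ↦ by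
    filter_upwards [hne p, mem_nhdsWithin_of_mem_nhds (hVo.mem_nhds hp)] with z h1 h2
    exact ⟨h2, h1⟩
  have hEc : IsConnected E := by
    refine ⟨?_, hVc.isPreconnected.diff_of_eventually_notMem hVo fun z _ ↦ hne z⟩
    obtain ⟨v, hv⟩ := hVc.nonempty
    exact (hisol v hv).exists
  have hEt : MapsTo f E (U \ {a}) := fun z hz ↦ ⟨hVU hz.1, hz.2⟩
  have hEcomp : ∀ S, IsPreconnected S → S ⊆ f ⁻¹' (U \ {a}) → (S ∩ E).Nonempty → S ⊆ E := by
    rintro S hS hSt ⟨x, hxS, hxE⟩ y hy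
    exact ⟨hV S hS (fun z hz ↦ (hSt hz).1) ⟨x, hxS, hxE.1⟩ hy, (hSt hy).2⟩
  have hφbt : BijOn φ (U \ {a}) (ball 0 1 \ {0}) := by
    have := hφb.sdiff_singleton haU
    rwa [hφa] at this
  have hφE : DifferentiableOn ℂ (fun z ↦ φ (f z)) V := hφ.comp hf.differentiableOn hVU
  have hgE : ∀ e ∈ E, DifferentiableAt ℂ (fun z ↦ φ (f z)) e := fun e he ↦
    hφE.differentiableAt (hVo.mem_nhds he.1)
  obtain ⟨h, hmaps, hsurj, hexp, hopen, d, hd⟩ := exists_lift_exp_halfPlane hcov hf.continuous hEo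
    hEc hEt hEcomp (hUo.sdiff isClosed_singleton) (hφ.continuousOn.mono sdiff_subset) hφbt
    (hφi.mono sdiff_subset) (hinv.mono sdiff_subset sdiff_subset)
  have hHo : IsOpen {z : ℂ | z.re < 0} := isOpen_lt Complex.continuous_re continuous_const
  rcases eq_or_ne d 0 with rfl | hd0
  · right
    obtain ⟨ψ, hψ, hψb, hψe⟩ := exists_differentiableOn_of_comp_eq (q := id) (P := Complex.exp)
      (P' := Complex.exp) (g := fun z ↦ φ (f z)) hHo hmaps hsurj hopen continuousOn_id
      (fun z hz w hw ↦ by simpa using hd z hz w hw)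
      (fun z _ ↦ Complex.hasStrictDerivAt_exp z) (fun z _ ↦ Complex.exp_ne_zero _)
      (fun z hz ↦ (hexp z hz).symm) hgE
    have hEV : E = V := by
      refine sdiff_subset.antisymm fun p hp ↦ ?_
      by_contra hpE
      have hfp : f p = a := by
        by_contra hfp
        exact hpE ⟨hp, hfp⟩
      refine not_eventually_exp_eq_of_eq_zero (hφE.analyticOnNhd hVo p hp)
        (by simp only [hfp, hφa]) ((hisol p hp).mono fun z hz ↦
          ⟨hψ.differentiableAt (hEo.mem_nhds hz), hψe z hz⟩)
    rw [image_id, hEV] at hψb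
    rw [hEV] at hψ hψe
    exact ⟨ψ, hψ, hψb, fun w hw ↦ (hψe w hw).symm⟩
  · left
    have hdc : (d : ℂ) ≠ 0 := Nat.cast_ne_zero.2 hd0
    obtain ⟨ψ, hψ, hψb, hψe⟩ := exists_differentiableOn_of_comp_eq
      (q := fun z ↦ Complex.exp (z / d)) (P := fun w ↦ w ^ d)
      (P' := fun w ↦ d * w ^ (d - 1)) (g := fun z ↦ φ (f z)) hHo hmaps hsurj hopen
      (by fun_prop)
      (fun z hz w hw ↦ by
        rw [hd z hz w hw, Complex.exp_eq_exp_iff_exists_int]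
        refine exists_congr fun k ↦ ?_
        rw [div_eq_iff hdc, add_mul, div_mul_cancel₀ _ hdc, mul_right_comm])
      (fun z _ ↦ hasStrictDerivAt_pow d _)
      (fun z _ ↦ mul_ne_zero hdc (pow_ne_zero _ (Complex.exp_ne_zero _)))
      (fun z hz ↦ by
        rw [hexp z hz, ← Complex.exp_nat_mul, mul_div_cancel₀ _ hdc]) hgE
    rw [image_exp_div_halfPlane hd0] at hψb
    have hEa : ∀ p ∈ V \ E, f p = a := by
      rintro p ⟨hp, hpE⟩
      by_contra hfp
      exact hpE ⟨hp, hfp⟩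
    obtain ⟨χ, hχ, hχi, hχm, hχψ, hχ0, hχe⟩ := exists_extension_pow_eq hd0 hVo hEo
      (fun p hp ↦ hisol p hp.1) hφE.continuousOn (fun p hp ↦ by simp only [hEa p hp, hφa])
      hψ hψb (fun z hz ↦ (hψe z hz).symm)
    refine ⟨d, Nat.one_le_iff_ne_zero.2 hd0, χ, hχ, ⟨hχm, hχi, fun w hw ↦ ?_⟩, hχe⟩
    by_cases hw0 : w = 0
    · by_cases hVE : V ⊆ E
      · have hEV : E = V := sdiff_subset.antisymm hVE
        rw [hEV] at hψ hψb hψe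
        refine (false_of_bijOn_punctured_ball hd0 hf hfc hUo hVo hV hφi (hφi0 ▸ haU) hψ hψb
          (fun z hz ↦ ?_) fun z hz ↦ hφi0 ▸ (hVE hz).2).elim
        rw [hψe z hz, hinv.1 (hVU hz)]
      · obtain ⟨p, hp⟩ := sdiff_nonempty.2 hVE
        exact ⟨p, hp.1, (hχ0 p hp).trans hw0.symm⟩
    · obtain ⟨z, hz, rfl⟩ := hψb.surjOn ⟨hw, hw0⟩
      exact ⟨z, hz.1, hχψ hz⟩

theorem coverings_of_punctured_disks
    (f : ℂ → ℂ) (hf : Differentiable ℂ f)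
    (htrans : ¬ ∃ p : Polynomial ℂ, ∀ z, f z = p.eval z)
    (a : ℂ) (U : Set ℂ)
    (hUne : U.Nonempty) (hUopen : IsOpen U) (hUconn : IsConnected U)
    (hUsc : SimplyConnectedSpace U) (hUproper : U ≠ univ)
    (haU : a ∈ U) (hsing : U ∩ {x | IsSingularValue f x} ⊆ {a})
    (V : Set ℂ) (v : ℂ) (hv : v ∈ f ⁻¹' U)
    (hV : V = connectedComponentIn (f ⁻¹' U) v) :
    IsOpen V ∧ IsConnected V ∧ SimplyConnectedSpace V ∧
      Xor'
        (∃ d : ℕ, 1 ≤ d ∧ ∃ ψ φ : ℂ → ℂ,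
          DifferentiableOn ℂ ψ V ∧ BijOn ψ V (ball (0 : ℂ) 1) ∧
          DifferentiableOn ℂ φ U ∧ BijOn φ U (ball (0 : ℂ) 1) ∧
          φ a = 0 ∧ ∀ w ∈ V, φ (f w) = (ψ w) ^ d)
        (∃ ψ φ : ℂ → ℂ,
          DifferentiableOn ℂ ψ V ∧ BijOn ψ V {z : ℂ | z.re < 0} ∧
          DifferentiableOn ℂ φ U ∧ BijOn φ U (ball (0 : ℂ) 1) ∧
          φ a = 0 ∧ ∀ w ∈ V, φ (f w) = Complex.exp (ψ w)) := by
  have hfc : ¬ ∃ c, ∀ z, f z = c := fun ⟨c, hc⟩ ↦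
    htrans ⟨Polynomial.C c, fun z ↦ by rw [hc z, Polynomial.eval_C]⟩
  have hVo : IsOpen V := hV ▸ (hUopen.preimage hf.continuous).connectedComponentIn
  have hVc : IsConnected V := hV ▸ isConnected_connectedComponentIn_iff.2 hv
  have hVU : V ⊆ f ⁻¹' U := hV ▸ connectedComponentIn_subset _ _
  have hVcomp : ∀ S : Set ℂ, IsPreconnected S → S ⊆ f ⁻¹' U → (S ∩ V).Nonempty → S ⊆ V := by
    rintro S hS hSU ⟨x, hxS, hxV⟩
    rw [hV] at hxV ⊢
    rw [connectedComponentIn_eq hxV]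
    exact hS.subset_connectedComponentIn hxS hSU
  have hcov : IsCoveringMapOn f (U \ {a}) :=
    isCoveringMapOn_of_not_isSingularValue hf.continuous fun w hw hs ↦ hw.2 (hsing ⟨hw.1, hs⟩)
  obtain ⟨φ, hφ, hφb, hφa⟩ := exists_differentiableOn_bijOn_ball hUopen hUsc hUproper haU
  have key := exists_exp_or_pow hf hfc hUopen haU hcov hVo hVc hVU hVcomp hφ hφb hφa
  refine ⟨hVo, hVc, ?_, (xor_iff_or_and_not_and _ _).2 ⟨?_, ?_⟩⟩
  · rcases key with ⟨d, -, ψ, hψ, hψb, -⟩ | ⟨ψ, hψ, hψb, -⟩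
    · exact IsSimplyConnected.of_bijOn hVo hψ hψb
        (.of_convex (convex_ball 0 1) ⟨0, mem_ball_self one_pos⟩)
    · exact IsSimplyConnected.of_bijOn hVo hψ hψb
        (.of_convex (convex_halfSpace_re_lt 0) ⟨-1, by simp⟩)
  · rcases key with ⟨d, hd, ψ, hψ, hψb, hψe⟩ | ⟨ψ, hψ, hψb, hψe⟩
    · exact .inl ⟨d, hd, ψ, φ, hψ, hψb, hφ, hφb, hφa, hψe⟩
    · exact .inr ⟨ψ, φ, hψ, hψb, hφ, hφb, hφa, hψe⟩
  · rintro ⟨⟨d, hd, ψ, φ, -, hψb, -, hφb, hφa, hψe⟩, ⟨χ, η, -, -, -, -, hηa, hχe⟩⟩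
    obtain ⟨p, hp, hp0⟩ := hψb.surjOn (mem_ball_self one_pos)
    have h1 := hψe p hp
    rw [hp0, zero_pow (Nat.one_le_iff_ne_zero.1 hd), ← hφa] at h1
    have h2 := hχe p hp
    rw [hφb.injOn (hVU hp) haU h1, hηa] at h2
    exact Complex.exp_ne_zero _ h2.symm
end
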